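/- arXiv:math/0209074 — 2 statements merged into one kernel-verified Lean document; each statement's English description precedes it below -/
import Mathlib

section
/- Let f : X → Y be a closed surjective continuous map of countable functional weight with dim f ≤ n (every fiber has covering dimension ≤ n), where X is normal Hausdorff and Y is a paracompact Hausdorff space with covering dimension dim Y ≤ m. Then the set of all g ∈ C(X, I^{2n+1+m}) such that f × g is an embedding and g satisfies condition (R) — namely dim(g(f⁻¹(y)) ∩ Π) ≤ k − n − 1 for every y ∈ Y and every rational k-plane Π in R^{2n+1+m} with 0 ≤ k ≤ 2n — is dense in C(X, I^{2n+1+m}) with respect to the uniform convergence topology generated by the Euclidean metric on I^{2n+1+m}. -/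
open Set Topology

noncomputable section

/-- The `k`-dimensional cube `I^k`, viewed inside Euclidean space with the Euclidean metric. -/
def cube (k : ℕ) : Set (EuclideanSpace ℝ (Fin k)) := {x | ∀ i, x i ∈ Set.Icc (0:ℝ) 1}

/-- The Hilbert cube `I^∞`, embedded in `ℓ²` as a closed convex subset; its metric `d_∞` is the
one induced by the `ℓ²` norm. -/
def HilbertCube : Set (lp (fun _ : ℕ => ℝ) 2) :=
  {x | ∀ i : ℕ, (x : ℕ → ℝ) i ∈ Set.Icc (0:ℝ) (1 / 2 ^ i)}

/-- Covering dimension of a topological space is at most `n` (as an integer, so that `n ≤ -1`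
means the space is empty): every finite open cover admits an open shrinking of order `≤ n + 1`. -/
def CovDimLE (X : Type*) [TopologicalSpace X] (n : ℤ) : Prop :=
  ∀ (ι : Type) (U : ι → Set X), Finite ι → (∀ i, IsOpen (U i)) → (⋃ i, U i) = Set.univ →
    ∃ V : ι → Set X, (∀ i, IsOpen (V i)) ∧ (∀ i, V i ⊆ U i) ∧ (⋃ i, V i) = Set.univ ∧
      ∀ x : X, (({i | x ∈ V i}).ncard : ℤ) ≤ n + 1

/-- A perfect map: continuous, closed, with compact fibers. -/
def IsPerfectMap {X Y : Type*} [TopologicalSpace X] [TopologicalSpace Y] (f : X → Y) : Prop :=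
  Continuous f ∧ IsClosedMap f ∧ ∀ y : Y, IsCompact (f ⁻¹' {y})

/-- `f` has countable (functional) weight: there is a continuous `h : X → I^∞` such that the
diagonal product `f × h` embeds `X` into `Y × I^∞`. -/
def HasCountableFunctionalWeight {X Y : Type*} [TopologicalSpace X] [TopologicalSpace Y]
    (f : X → Y) : Prop :=
  ∃ h : C(X, ↥HilbertCube), IsEmbedding (fun x => (f x, h x) : X → Y × ↥HilbertCube)

/-- `h` restricted to `A` is an `ω`-map: every point of `A` has a neighborhood `V` of its image
whose preimage within `A` is contained in some member of `ω`. -/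
def IsOmegaMapOn {X Z : Type*} [TopologicalSpace X] [TopologicalSpace Z]
    (ω : Set (Set X)) (h : X → Z) (A : Set X) : Prop :=
  ∀ x ∈ A, ∃ V ∈ nhds (h x), ∃ W ∈ ω, A ∩ h ⁻¹' V ⊆ W

/-- A set `U ⊆ C(X, M)` is open in the source limitation (fine) topology: every `g ∈ U` admits a
continuous `α : X → (0, ∞)` with `B̄(g, α) ⊆ U`. -/
def SLOpen {X M : Type*} [TopologicalSpace X] [PseudoMetricSpace M] (U : Set C(X, M)) : Prop :=
  ∀ g ∈ U, ∃ α : C(X, ℝ), (∀ x, 0 < α x) ∧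
    {h : C(X, M) | ∀ x, dist (g x) (h x) ≤ α x} ⊆ U

/-- A set `D ⊆ C(X, M)` is dense in the source limitation topology. -/
def SLDense {X M : Type*} [TopologicalSpace X] [PseudoMetricSpace M] (D : Set C(X, M)) : Prop :=
  ∀ U : Set C(X, M), SLOpen U → U.Nonempty → (U ∩ D).Nonempty

/-- A set `D ⊆ C(X, M)` is a `G_δ`-set in the source limitation topology. -/
def SLGdelta {X M : Type*} [TopologicalSpace X] [PseudoMetricSpace M] (D : Set C(X, M)) : Prop :=
  ∃ F : ℕ → Set C(X, M), (∀ i, SLOpen (F i)) ∧ D = ⋂ i, F i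

/-- `Y` is a `C`-space: for every sequence `ω` of open covers there are pairwise disjoint open
families `γ i`, with `γ i` refining `ω i`, whose union covers `Y`. -/
def IsCSpace (Y : Type*) [TopologicalSpace Y] : Prop :=
  ∀ ω : ℕ → Set (Set Y), (∀ i, ∀ U ∈ ω i, IsOpen U) → (∀ i, ⋃₀ ω i = Set.univ) →
    ∃ γ : ℕ → Set (Set Y),
      (∀ i, ∀ U ∈ γ i, IsOpen U) ∧
      (∀ i, (γ i).Pairwise Disjoint) ∧
      (∀ i, ∀ U ∈ γ i, ∃ W ∈ ω i, U ⊆ W) ∧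
      ⋃₀ (⋃ i, γ i) = Set.univ

/-- A closed set `F` in a metric space `M` is a `Z_m`-set: the maps `I^m → M` avoiding `F` are
dense in the space of maps `I^m → M` with the uniform convergence (sup-metric) topology. -/
def IsZSet {M : Type*} [PseudoMetricSpace M] (m : ℕ) (F : Set M) : Prop :=
  IsClosed F ∧ Dense {u : BoundedContinuousFunction ↥(cube m) M | ∀ z, u z ∉ F}

/-- A `σZ_m`-set: a countable union of closed `Z_m`-sets. -/
def IsSigmaZSet {M : Type*} [PseudoMetricSpace M] (m : ℕ) (S : Set M) : Prop :=
  ∃ F : ℕ → Set M, (∀ i, IsZSet m (F i)) ∧ S = ⋃ i, F i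

/-- A `k`-plane in `ℝ^p`: the set where `p - k` fixed coordinates take fixed real values. -/
def IsPlane (p k : ℕ) (P : Set (EuclideanSpace ℝ (Fin p))) : Prop :=
  ∃ (s : Finset (Fin p)) (r : Fin p → ℝ), s.card = p - k ∧
    P = {x | ∀ i ∈ s, x i = r i}

/-- A rational `k`-plane in `ℝ^p`: the fixed coordinate values are rational. -/
def IsRatPlane (p k : ℕ) (P : Set (EuclideanSpace ℝ (Fin p))) : Prop :=
  ∃ (s : Finset (Fin p)) (r : Fin p → ℚ), s.card = p - k ∧
    P = {x | ∀ i ∈ s, x i = (r i : ℝ)}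

/-- Condition (R): `dim (g(f⁻¹(y)) ∩ Π) ≤ k - n - 1` for every `y ∈ Y` and every rational
`k`-plane `Π` in `ℝ^{2n+1+m}` with `0 ≤ k ≤ 2n`. -/
def ConditionR {X Y : Type*} [TopologicalSpace X] [TopologicalSpace Y]
    (f : X → Y) (n m : ℕ) (g : X → ↥(cube (2*n+1+m))) : Prop :=
  ∀ y : Y, ∀ k : ℕ, k ≤ 2*n → ∀ P : Set (EuclideanSpace ℝ (Fin (2*n+1+m))),
    IsRatPlane (2*n+1+m) k P →
    CovDimLE ↥(((fun x => ((g x : EuclideanSpace ℝ (Fin (2*n+1+m))))) '' (f ⁻¹' {y})) ∩ P)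
      ((k : ℤ) - n - 1)

/-- The restriction `f|B` is σ-perfect with countable weight: `B = ⋃ᵢ Bᵢ` with `Bᵢ ⊆ X` closed,
`f(Bᵢ) ⊆ Y` closed, and each `f|Bᵢ : Bᵢ → f(Bᵢ)` a perfect map of countable weight. -/
def SigmaPerfectCW {X Y : Type*} [TopologicalSpace X] [TopologicalSpace Y]
    (f : X → Y) (B : Set X) : Prop :=
  ∃ Bi : ℕ → Set X, B = ⋃ i, Bi i ∧ ∀ i : ℕ,
    IsClosed (Bi i) ∧ IsClosed (f '' Bi i) ∧
    IsPerfectMap ((Set.mapsTo_image f (Bi i)).restrict f (Bi i) (f '' Bi i)) ∧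
    HasCountableFunctionalWeight ((Set.mapsTo_image f (Bi i)).restrict f (Bi i) (f '' Bi i))

/-- From a partition of unity to countably many functions whose cozero sets are unions of
disjoint open sets subordinate to the partition. -/
theorem partition_to_layers {Y ι : Type*} [TopologicalSpace Y] (ρ : PartitionOfUnity ι Y univ) :
    ∃ (κ : ℕ → Y → ℝ) (β : ℕ → Y → ι), (∀ j, Continuous (κ j)) ∧ (∀ j y, 0 ≤ κ j y) ∧
      (∀ j y, 0 < κ j y → 0 < ρ (β j y) y) ∧
      (∀ j y, 0 < κ j y → ∀ᶠ y' in 𝓝 y, β j y' = β j y) ∧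
      (∀ y, ∃ j, 0 < κ j y ∧ j + 1 = (ρ.finsupport y).card) := by
  classical
  let kt : Finset ι → Y → ℝ := fun T y => ∏ i ∈ T, max 0 (ρ i y + ∑ l ∈ T, ρ l y - 1)
  have kt_cont : ∀ T, Continuous (kt T) := by
    intro T
    refine continuous_finset_prod _ fun i _ => ?_
    fun_prop
  have kt_nonneg : ∀ T y, 0 ≤ kt T y := fun T y => Finset.prod_nonneg fun i _ => le_max_left _ _
  have kt_pos : ∀ T y, 0 < kt T y ↔ ∀ i ∈ T, 0 < ρ i y + ∑ l ∈ T, ρ l y - 1 := by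
    intro T y
    constructor
    · intro h i hi
      by_contra hc
      have : kt T y = 0 := Finset.prod_eq_zero hi (max_eq_left (not_lt.1 hc))
      linarith
    · intro h
      exact Finset.prod_pos fun i hi => lt_max_of_lt_right (h i hi)
  have sum_le : ∀ (T : Finset ι) y, ∑ l ∈ T, ρ l y ≤ 1 := by
    intro T y
    rw [← ρ.sum_finsupport' (mem_univ y) (I := T ∪ ρ.finsupport y) Finset.subset_union_right]
    exact Finset.sum_le_sum_of_subset_of_nonneg Finset.subset_union_left
      fun i _ _ => ρ.nonneg i y
  have kt_mem : ∀ T y, 0 < kt T y → ∀ i ∈ T, 0 < ρ i y := by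
    intro T y h i hi
    have := (kt_pos T y).1 h i hi
    have := sum_le T y
    linarith
  have kt_uniq : ∀ T T' y, T.card = T'.card → 0 < kt T y → 0 < kt T' y → T = T' := by
    intro T T' y hc h h'
    by_contra hne
    have h1 : ¬ T ⊆ T' := fun hs => hne (Finset.eq_of_subset_of_card_le hs hc.ge)
    have h2 : ¬ T' ⊆ T := fun hs => hne (Finset.eq_of_subset_of_card_le hs hc.le).symm
    obtain ⟨a, ha, ha'⟩ := Finset.not_subset.1 h1
    obtain ⟨b, hb, hb'⟩ := Finset.not_subset.1 h2
    have e1 := (kt_pos T y).1 h a ha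
    have e2 := (kt_pos T' y).1 h' b hb
    have e3 := sum_le (insert b T) y
    have e4 := sum_le (insert a T') y
    rw [Finset.sum_insert hb'] at e3
    rw [Finset.sum_insert ha'] at e4
    linarith
  let Ix : ℕ → Type _ := fun j => {T : Finset ι // T.card = j + 1}
  have lf : ∀ j, LocallyFinite fun T : Ix j => Function.support (kt T.1) := by
    intro j y
    obtain ⟨N, hN, hfin⟩ := ρ.locallyFinite y
    refine ⟨N, hN, ?_⟩
    have : ({T : Finset ι | (T : Set ι) ⊆ {i | ((Function.support (ρ i)) ∩ N).Nonempty}}).Finite := by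
      have := hfin.toFinset.powerset.finite_toSet
      refine this.subset ?_
      intro T hT
      simp only [Finset.coe_powerset, mem_preimage, mem_powerset_iff, Finite.coe_toFinset]
      exact hT
    refine Set.Finite.of_injOn (f := fun T : Ix j => T.1) ?_ (Subtype.val_injective.injOn) this
    rintro T ⟨y', hy', hN'⟩ i hi
    refine ⟨y', ?_, hN'⟩
    have := kt_mem T.1 y' (lt_of_le_of_ne (kt_nonneg _ _) (Ne.symm hy')) i hi
    exact this.ne'
  let κ : ℕ → Y → ℝ := fun j y => ∑ᶠ T : Ix j, kt T.1 y
  have κpos : ∀ j y, 0 < κ j y ↔ ∃ T : Ix j, 0 < kt T.1 y := by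
    intro j y
    constructor
    · intro h
      by_contra hc
      push Not at hc
      have : κ j y = 0 := finsum_eq_zero_of_forall_eq_zero
        fun T => le_antisymm (hc T) (kt_nonneg _ _)
      linarith
    · rintro ⟨T, hT⟩
      have : κ j y = kt T.1 y := finsum_eq_single _ T fun T' hT' => by
        by_contra hne
        apply hT'
        apply Subtype.ext
        exact kt_uniq _ _ y (T'.2.trans T.2.symm) (lt_of_le_of_ne (kt_nonneg _ _) (Ne.symm hne)) hT
      rw [this]; exact hT
  have pick : ∀ y : Y, Nonempty ι := fun y => ⟨(ρ.exists_pos (mem_univ y)).choose⟩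
  have ne : ∀ (j) (T : Ix j), T.1.Nonempty := fun j T => Finset.card_pos.1 (by rw [T.2]; omega)
  let β : ℕ → Y → ι := fun j y =>
    if h : ∃ T : Ix j, 0 < kt T.1 y then (ne j h.choose).choose else (pick y).some
  have βeq : ∀ j y (T : Ix j), 0 < kt T.1 y → β j y = (ne j T).choose := by
    intro j y T hT
    have h : ∃ T : Ix j, 0 < kt T.1 y := ⟨T, hT⟩
    have : h.choose = T := Subtype.ext
      (kt_uniq _ _ y (h.choose.2.trans T.2.symm) h.choose_spec hT)
    simp only [β, dif_pos h]
    rw [this]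
  refine ⟨κ, β, ?_, ?_, ?_, ?_, ?_⟩
  · intro j
    exact continuous_finsum (fun T => kt_cont _) (lf j)
  · intro j y
    exact finsum_nonneg fun T => kt_nonneg _ _
  · intro j y h
    obtain ⟨T, hT⟩ := (κpos j y).1 h
    rw [βeq j y T hT]
    exact kt_mem _ _ hT _ (ne j T).choose_spec
  · intro j y h
    obtain ⟨T, hT⟩ := (κpos j y).1 h
    filter_upwards [(kt_cont T.1).continuousAt.eventually (lt_mem_nhds hT)] with y' hy'
    rw [βeq j y T hT, βeq j y' T hy']
  · intro y
    have hne : (ρ.finsupport y).Nonempty := by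
      obtain ⟨i, hi⟩ := ρ.exists_pos (mem_univ y)
      exact ⟨i, (ρ.mem_finsupport y).2 hi.ne'⟩
    obtain ⟨j, hj⟩ := Nat.exists_eq_succ_of_ne_zero (Finset.card_pos.2 hne).ne'
    refine ⟨j, (κpos j y).2 ⟨⟨ρ.finsupport y, hj⟩, ?_⟩, hj.symm⟩
    rw [kt_pos]
    intro i hi
    rw [ρ.sum_finsupport (mem_univ y)]
    have : ρ i y ≠ 0 := (ρ.mem_finsupport y).1 hi
    have := lt_of_le_of_ne (ρ.nonneg i y) (Ne.symm this)
    linarith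

/-- One step of the shrinking procedure. -/
theorem shrink_step {Y : Type*} [TopologicalSpace Y] {m : ℕ} (hY : CovDimLE Y m)
    (U : ℕ → Set Y) (hU : ∀ i, IsOpen (U i)) (hc : ⋃ i, U i = univ) (T : Finset ℕ)
    (hT : T.card = m + 2) :
    ∃ V : ℕ → Set Y, (∀ i, IsOpen (V i)) ∧ (∀ i, V i ⊆ U i) ∧ (⋃ i, V i = univ) ∧
      (⋂ i ∈ T, V i) = ∅ ∧
      ∀ O : Set Y, IsOpen O → O ∩ (⋂ i ∈ T, U i) = ∅ → ∀ i, V i ∩ O = U i ∩ O := by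
  classical
  obtain ⟨W, hWo, hWs, hWc, hWn⟩ := hY (Option T)
    (fun o => o.elim (⋃ i ∈ {i | i ∉ T}, U i) (fun i => U i)) inferInstance
    (by
      rintro (_ | i)
      · exact isOpen_biUnion fun i _ => hU i
      · exact hU i)
    (by
      rw [eq_univ_iff_forall] at hc ⊢
      intro y
      obtain ⟨i, hi⟩ := mem_iUnion.1 (hc y)
      by_cases h : i ∈ T
      · exact mem_iUnion.2 ⟨some ⟨i, h⟩, hi⟩
      · exact mem_iUnion.2 ⟨none, mem_biUnion (x := i) h hi⟩)
  have hempty : ∀ y, ¬ ∀ i : T, y ∈ W (some i) := by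
    intro y hy
    have h1 := hWn y
    have h2 : (range (some : T → Option T)) ⊆ {i | y ∈ W i} := by
      rintro _ ⟨i, rfl⟩; exact hy i
    have h3 := Set.ncard_le_ncard h2 (Set.toFinite _)
    rw [Set.ncard_range_of_injective (Option.some_injective _)] at h3
    simp [hT] at h3
    omega
  let C := closure (⋂ i ∈ T, U i)
  refine ⟨fun i => if h : i ∈ T then W (some ⟨i, h⟩) ∪ (U i \ C) else U i, ?_, ?_, ?_, ?_, ?_⟩
  · intro i
    dsimp only
    split_ifs with h
    · exact (hWo _).union ((hU i).sdiff isClosed_closure)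
    · exact hU i
  · intro i
    dsimp only
    split_ifs with h
    · exact union_subset (hWs (some ⟨i, h⟩)) diff_subset
    · exact subset_rfl
  · rw [eq_univ_iff_forall] at hWc ⊢
    intro y
    obtain ⟨o, ho⟩ := mem_iUnion.1 (hWc y)
    rcases o with _ | i
    · have := hWs none ho
      simp only [Option.elim, mem_setOf_eq, mem_iUnion, exists_prop] at this
      obtain ⟨i, hi, hy⟩ := this
      refine mem_iUnion.2 ⟨i, ?_⟩
      rw [dif_neg hi]; exact hy
    · refine mem_iUnion.2 ⟨i.1, ?_⟩
      rw [dif_pos i.2]; exact Or.inl ho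
  · rw [eq_empty_iff_forall_notMem]
    intro y hy
    simp only [mem_iInter] at hy
    by_cases hyC : y ∈ C
    · apply hempty y
      intro i
      have := hy i.1 i.2
      rw [dif_pos i.2] at this
      rcases this with h | h
      · exact h
      · exact absurd hyC h.2
    · apply hyC
      apply subset_closure
      simp only [mem_iInter]
      intro i hi
      have := hy i hi
      rw [dif_pos hi] at this
      rcases this with h | h
      · exact hWs (some ⟨i, hi⟩) h
      · exact h.1
  · intro O hO hOT i
    have hOC : Disjoint O C := by
      apply Disjoint.closure_right _ hO
      exact disjoint_iff_inter_eq_empty.2 hOT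
    dsimp only
    split_ifs with h
    · apply subset_antisymm
      · exact inter_subset_inter_left _ (union_subset (hWs (some ⟨i, h⟩)) diff_subset)
      · rintro y ⟨hy, hyO⟩
        exact ⟨Or.inr ⟨hy, fun hyC => hOC.le_bot ⟨hyO, hyC⟩⟩, hyO⟩
    · rfl

theorem countable_shrink {Y : Type*} [TopologicalSpace Y] {m : ℕ} (hY : CovDimLE Y m)
    (U : ℕ → Set Y) (hU : ∀ i, IsOpen (U i)) (hc : ⋃ i, U i = univ) (hlf : LocallyFinite U) :
    ∃ V : ℕ → Set Y, (∀ i, IsOpen (V i)) ∧ (∀ i, V i ⊆ U i) ∧ (⋃ i, V i = univ) ∧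
      ∀ T : Finset ℕ, T.card = m + 2 → (⋂ i ∈ T, V i) = ∅ := by
  classical
  have : Infinite {T : Finset ℕ // T.card = m + 2} := by
    refine Infinite.of_injective (fun k : ℕ => (⟨Finset.Ico k (k + (m + 2)), by simp⟩ :
      {T : Finset ℕ // T.card = m + 2})) ?_
    intro a b hab
    have h := Subtype.ext_iff.1 hab
    simp only at h
    have ha : a ∈ Finset.Ico b (b + (m+2)) := by rw [← h]; simp
    have hb : b ∈ Finset.Ico a (a + (m+2)) := by rw [h]; simp
    simp at ha hb
    omega
  obtain ⟨en⟩ : Nonempty (ℕ ≃ {T : Finset ℕ // T.card = m + 2}) :=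
    nonempty_equiv_of_countable
  let St := {U : ℕ → Set Y // (∀ i, IsOpen (U i)) ∧ ⋃ i, U i = univ}
  have step := fun (S : St) (k : ℕ) => shrink_step hY S.1 S.2.1 S.2.2 (en k).1 (en k).2
  choose N hNo hNs hNc hNe hNl using step
  let seq : ℕ → St := fun k => Nat.rec ⟨U, hU, hc⟩ (fun k S => ⟨N S k, hNo S k, hNc S k⟩) k
  have seq_succ : ∀ k, (seq (k+1)).1 = N (seq k) k := fun k => rfl
  have anti : ∀ i, Antitone fun k => (seq k).1 i := by
    intro i
    refine antitone_nat_of_succ_le fun k => ?_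
    rw [seq_succ]; exact hNs _ _ i
  have stab : ∀ y, ∃ O, IsOpen O ∧ y ∈ O ∧ ∃ K, ∀ k ≥ K, ∀ i, (seq k).1 i ∩ O = (seq K).1 i ∩ O := by
    intro y
    obtain ⟨O', hO', hfin⟩ := hlf y
    obtain ⟨O, hOs, hO, hyO⟩ := mem_nhds_iff.1 hO'
    refine ⟨O, hO, hyO, ?_⟩
    have hTf : ({k | ((en k).1 : Set ℕ) ⊆ {i | (U i ∩ O').Nonempty}}).Finite := by
      refine Set.Finite.of_injOn (f := fun k => (en k).1) (t := ↑(hfin.toFinset.powerset)) ?_ ?_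
        (Finset.finite_toSet _)
      · intro k hk
        simp only [Finset.coe_powerset, mem_preimage, mem_powerset_iff, Finite.coe_toFinset]
        exact hk
      · exact (Subtype.val_injective.comp en.injective).injOn
    obtain ⟨K, hK⟩ := hTf.bddAbove
    refine ⟨K + 1, ?_⟩
    intro k hk
    induction k, hk using Nat.le_induction with
    | base => intro i; rfl
    | succ k hk ih =>
      intro i
      rw [← ih i, seq_succ]
      refine hNl (seq k) k O hO ?_ i
      rw [eq_empty_iff_forall_notMem]
      rintro z ⟨hzO, hz⟩
      simp only [mem_iInter] at hz
      have : k ≤ K := hK (by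
        intro i hi
        exact ⟨z, anti i (Nat.zero_le k) (hz i hi), hOs hzO⟩)
      omega
  refine ⟨fun i => ⋂ k, (seq k).1 i, ?_, ?_, ?_, ?_⟩
  · intro i
    rw [isOpen_iff_mem_nhds]
    intro y hy
    obtain ⟨O, hO, hyO, K, hK⟩ := stab y
    filter_upwards [((seq K).2.1 i).mem_nhds (mem_iInter.1 hy K), hO.mem_nhds hyO] with z hz hzO
    rw [mem_iInter]
    intro k
    rcases le_total K k with h | h
    · have : z ∈ (seq k).1 i ∩ O := by rw [hK k h i]; exact ⟨hz, hzO⟩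
      exact this.1
    · exact anti i h hz
  · intro i
    exact iInter_subset (fun k => (seq k).1 i) 0
  · rw [eq_univ_iff_forall]
    intro y
    obtain ⟨O, hO, hyO, K, hK⟩ := stab y
    have := (seq K).2.2
    rw [eq_univ_iff_forall] at this
    obtain ⟨i, hi⟩ := mem_iUnion.1 (this y)
    refine mem_iUnion.2 ⟨i, mem_iInter.2 fun k => ?_⟩
    rcases le_total K k with h | h
    · have : y ∈ (seq k).1 i ∩ O := by rw [hK k h i]; exact ⟨hi, hyO⟩
      exact this.1
    · exact anti i h hi
  · intro T hT
    rw [eq_empty_iff_forall_notMem]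
    intro y hy
    simp only [mem_iInter] at hy
    have h := hNe (seq (en.symm ⟨T, hT⟩)) (en.symm ⟨T, hT⟩)
    rw [eq_empty_iff_forall_notMem] at h
    apply h y
    simp only [mem_iInter, Equiv.apply_symm_apply]
    intro i hi
    exact hy i hi (en.symm ⟨T, hT⟩ + 1)

/-- The form of `dim Y ≤ m` used in the selection argument. -/
theorem layers_of_dim {Y B : Type*} [TopologicalSpace Y] [T2Space Y] [ParacompactSpace Y] {m : ℕ}
    (hY : CovDimLE Y m) (O : B → Set Y) (hO : ∀ b, IsOpen (O b)) (hc : ⋃ b, O b = univ) :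
    ∃ (l : ℕ → Y → ℝ) (β : ℕ → Y → B), (∀ j, Continuous (l j)) ∧
      (∀ j y, l j y ∈ Icc (0:ℝ) 1) ∧ (∀ j y, 0 < l j y → y ∈ O (β j y)) ∧
      (∀ j y, 0 < l j y → ∀ᶠ y' in 𝓝 y, β j y' = β j y) ∧
      (∀ y, ∃ j, j < m + 1 ∧ l j y = 1) := by
  classical
  obtain ⟨ρ, hρ⟩ := PartitionOfUnity.exists_isSubordinate isClosed_univ O hO (by rw [hc])
  obtain ⟨κ, β, hκc, hκ0, hκρ, hβ, hκex⟩ := partition_to_layers ρ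
  have hcov : ⋃ j, {y | 0 < κ j y} = univ := by
    rw [eq_univ_iff_forall]
    intro y
    obtain ⟨j, hj, _⟩ := hκex y
    exact mem_iUnion.2 ⟨j, hj⟩
  obtain ⟨U, hUo, hUc, hUlf, hUs⟩ := precise_refinement (fun j => {y | 0 < κ j y})
    (fun j => isOpen_lt continuous_const (hκc j)) hcov
  obtain ⟨V, hVo, hVs, hVc, hVe⟩ := countable_shrink hY U hUo hUc hUlf
  obtain ⟨σ, hσ⟩ := PartitionOfUnity.exists_isSubordinate isClosed_univ V hVo (by rw [hVc])
  have hσV : ∀ i y, 0 < σ i y → y ∈ V i := fun i y h => hσ i (subset_tsupport _ h.ne')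
  obtain ⟨κ', β', hκc', hκ0', hκρ', hβ', hκex'⟩ := partition_to_layers σ
  have hex : ∀ y, ∃ j ∈ Finset.range (m+1), 0 < κ' j y := by
    intro y
    obtain ⟨j, hj, hjc⟩ := hκex' y
    refine ⟨j, ?_, hj⟩
    rw [Finset.mem_range]
    by_contra hcon
    obtain ⟨T, hT, hTc⟩ := Finset.exists_subset_card_eq (s := σ.finsupport y) (n := m + 2)
      (by omega)
    have := hVe T hTc
    rw [eq_empty_iff_forall_notMem] at this
    apply this y
    simp only [mem_iInter]
    intro i hi
    exact hσV i y (lt_of_le_of_ne (σ.nonneg i y) (Ne.symm ((σ.mem_finsupport y).1 (hT hi))))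
  have hrange : (Finset.range (m+1)).Nonempty := ⟨0, by simp⟩
  let M : Y → ℝ := fun y => (Finset.range (m+1)).sup' hrange fun j => κ' j y
  have hMc : Continuous M := Continuous.finset_sup'_apply hrange fun i _ => hκc' i
  have hMpos : ∀ y, 0 < M y := by
    intro y
    obtain ⟨j, hj, h⟩ := hex y
    exact h.trans_le (Finset.le_sup' (fun j => κ' j y) hj)
  refine ⟨fun j y => min 1 (κ' j y / M y), fun j y => β (β' j y) y, ?_, ?_, ?_, ?_, ?_⟩
  · intro j
    exact continuous_const.min ((hκc' j).div hMc fun y => (hMpos y).ne')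
  · intro j y
    exact ⟨le_min zero_le_one (div_nonneg (hκ0' j y) (hMpos y).le), min_le_left _ _⟩
  · intro j y h
    have h1 : 0 < κ' j y := by
      have := (lt_min_iff.1 h).2
      exact (div_pos_iff_of_pos_right (hMpos y)).1 this
    have h2 : 0 < κ (β' j y) y := hUs _ (hVs _ (hσV _ _ (hκρ' j y h1)))
    exact hρ _ (subset_tsupport _ (hκρ _ _ h2).ne')
  · intro j y h
    have h1 : 0 < κ' j y := by
      have := (lt_min_iff.1 h).2
      exact (div_pos_iff_of_pos_right (hMpos y)).1 this
    have h2 : 0 < κ (β' j y) y := hUs _ (hVs _ (hσV _ _ (hκρ' j y h1)))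
    filter_upwards [hβ' j y h1, hβ _ _ h2] with y' e1 e2
    rw [e1, e2]
  · intro y
    obtain ⟨j, hj, he⟩ := Finset.exists_mem_eq_sup' hrange fun j => κ' j y
    refine ⟨j, Finset.mem_range.1 hj, ?_⟩
    have : κ' j y / M y = 1 := by
      have : M y = κ' j y := he
      rw [this, div_self]
      rw [← this]; exact (hMpos y).ne'
    simp [this]

def SmallSet {E : Type*} [PseudoMetricSpace E] (j : ℕ) (K : Set E) : Prop :=
  ∃ S : Set (Σ d : ℕ, ((Fin d → ℝ) → E)), S.Countable ∧
    (∀ s ∈ S, s.1 < j ∧ LocallyLipschitz s.2) ∧ K ⊆ ⋃ s ∈ S, range s.2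

theorem SmallSet.mono {E : Type*} [PseudoMetricSpace E] {i j : ℕ} {K L : Set E} (h : SmallSet i K)
    (hij : i ≤ j) (hL : L ⊆ K) : SmallSet j L := by
  obtain ⟨S, h1, h2, h3⟩ := h
  exact ⟨S, h1, fun s hs => ⟨(h2 s hs).1.trans_le hij, (h2 s hs).2⟩, hL.trans h3⟩

theorem SmallSet.empty {E : Type*} [PseudoMetricSpace E] (j : ℕ) : SmallSet j (∅ : Set E) :=
  ⟨∅, countable_empty, by simp, by simp⟩

theorem SmallSet.biUnion {E ι : Type*} [PseudoMetricSpace E] {j : ℕ} {T : Set ι} (hT : T.Countable)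
    {K : ι → Set E} (h : ∀ i ∈ T, SmallSet j (K i)) : SmallSet j (⋃ i ∈ T, K i) := by
  choose! S h1 h2 h3 using h
  refine ⟨⋃ i ∈ T, S i, hT.biUnion h1, ?_, ?_⟩
  · intro s hs
    simp only [mem_iUnion] at hs
    obtain ⟨i, hi, hs⟩ := hs
    exact h2 i hi s hs
  · intro x hx
    simp only [mem_iUnion] at hx
    obtain ⟨i, hi, hx⟩ := hx
    have := h3 i hi hx
    simp only [mem_iUnion] at this ⊢
    obtain ⟨s, hs, hx⟩ := this
    exact ⟨s, ⟨i, hi, hs⟩, hx⟩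

theorem SmallSet.union {E : Type*} [PseudoMetricSpace E] {j : ℕ} {K L : Set E} (hK : SmallSet j K)
    (hL : SmallSet j L) : SmallSet j (K ∪ L) := by
  have : K ∪ L = ⋃ b ∈ (univ : Set Bool), cond b K L := by
    ext x; simp [or_comm]
  rw [this]
  exact SmallSet.biUnion (to_countable _) (by rintro (_ | _) _ <;> assumption)

theorem SmallSet.singleton {E : Type*} [PseudoMetricSpace E] (j : ℕ) (z : E) :
    SmallSet (j + 1) ({z} : Set E) :=
  ⟨{⟨0, fun _ => z⟩}, countable_singleton _, by
    rintro s rfl; exact ⟨by simp, LocallyLipschitz.const z⟩, by simp⟩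

theorem SmallSet.prod {E : Type*} [PseudoMetricSpace E] {j : ℕ} {K : Set E} (hK : SmallSet j K)
    {e : E × ℝ → E} (he : LocallyLipschitz e) : SmallSet (j + 1) (e '' (K ×ˢ univ)) := by
  obtain ⟨S, h1, h2, h3⟩ := hK
  refine ⟨(fun s : (Σ d : ℕ, ((Fin d → ℝ) → E)) =>
    (⟨s.1 + 1, fun v => e (s.2 (fun i => v i.succ), v 0)⟩ : Σ d : ℕ, ((Fin d → ℝ) → E))) '' S,
    h1.image _, ?_, ?_⟩
  · rintro _ ⟨s, hs, rfl⟩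
    refine ⟨Nat.succ_lt_succ (h2 s hs).1, he.comp (LocallyLipschitz.prodMk ?_ ?_)⟩
    · refine (h2 s hs).2.comp (f := s.2) (g := fun v : Fin (s.1+1) → ℝ => fun i : Fin s.1 => v i.succ) ?_
      have : ContDiff ℝ 1 (fun v : Fin (s.1+1) → ℝ => fun i : Fin s.1 => v i.succ) := by fun_prop
      exact this.locallyLipschitz
    · have : ContDiff ℝ 1 (fun v : Fin (s.1+1) → ℝ => v 0) := by fun_prop
      exact this.locallyLipschitz
  · rintro _ ⟨⟨k, t⟩, ⟨hk, -⟩, rfl⟩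
    have := h3 hk
    simp only [mem_iUnion] at this
    obtain ⟨s, hs, v, hv⟩ := this
    simp only [mem_iUnion]
    refine ⟨_, ⟨s, hs, rfl⟩, Fin.cons t v, ?_⟩
    simp [hv]

theorem selection_step {Y E : Type*} [TopologicalSpace Y] [T2Space Y] [ParacompactSpace Y]
    [PseudoMetricSpace E] {j : ℕ}
    (Γ : Y → Set E) (hΓ : IsOpen {p : Y × E | p.2 ∈ Γ p.1})
    (hcone : ∀ y, ∀ K : Set E, IsCompact K → K ⊆ Γ y → SmallSet j K →
      ∃ (e : E × ℝ → E) (z : E), LocallyLipschitz e ∧ (∀ k, e (k, 0) = k) ∧ (∀ k, e (k, 1) = z) ∧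
        z ∈ Γ y ∧ ∀ k ∈ K, ∀ s ∈ Icc (0:ℝ) 1, e (k, s) ∈ Γ y)
    (𝒦 : Y → Set E) (O : Y → Set Y) (hKc : ∀ y, IsCompact (𝒦 y)) (hKs : ∀ y, SmallSet j (𝒦 y))
    (hKΓ : ∀ y, 𝒦 y ⊆ Γ y) (hKu : ∀ y, ∀ᶠ y' in 𝓝 y, 𝒦 y' ⊆ 𝒦 y)
    (hO : ∀ y, IsOpen (O y)) (hyO : ∀ y, y ∈ O y)
    (hφ : ∀ (l : ℕ → Y → ℝ) (β : ℕ → Y → Y), (∀ j, Continuous (l j)) → (∀ j y, l j y ∈ Icc (0:ℝ) 1) →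
      (∀ j y, 0 < l j y → y ∈ O (β j y)) → (∀ j y, 0 < l j y → ∀ᶠ y' in 𝓝 y, β j y' = β j y) →
      ∃ φ : Y → E, Continuous φ ∧ ∀ y, (∃ i < j, l i y = 1) → φ y ∈ 𝒦 y) :
    ∃ (𝒦 : Y → Set E) (O : Y → Set Y), (∀ y, IsCompact (𝒦 y)) ∧ (∀ y, SmallSet (j+1) (𝒦 y)) ∧
    (∀ y, 𝒦 y ⊆ Γ y) ∧ (∀ y, ∀ᶠ y' in 𝓝 y, 𝒦 y' ⊆ 𝒦 y) ∧
    (∀ y, IsOpen (O y)) ∧ (∀ y, y ∈ O y) ∧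
    (∀ (l : ℕ → Y → ℝ) (β : ℕ → Y → Y), (∀ j, Continuous (l j)) → (∀ j y, l j y ∈ Icc (0:ℝ) 1) →
      (∀ j y, 0 < l j y → y ∈ O (β j y)) → (∀ j y, 0 < l j y → ∀ᶠ y' in 𝓝 y, β j y' = β j y) →
      ∃ φ : Y → E, Continuous φ ∧ ∀ y, (∃ i < j + 1, l i y = 1) → φ y ∈ 𝒦 y) := by
  choose e z he he0 he1 hz heΓ using fun y => hcone y (𝒦 y) (hKc y) (hKΓ y) (hKs y)
  -- the compact pieces
  set C : Y → Set E := fun b => e b '' (𝒦 b ×ˢ Icc (0:ℝ) 1) ∪ {z b} with hC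
  have hCc : ∀ b, IsCompact (C b) := fun b =>
    (((hKc b).prod isCompact_Icc).image (he b).continuous).union isCompact_singleton
  have hCΓ : ∀ b, C b ⊆ Γ b := by
    rintro b x (⟨⟨k, s⟩, ⟨hk, hs⟩, rfl⟩ | rfl)
    · exact heΓ b k hk s hs
    · exact hz b
  have hCs : ∀ b, SmallSet (j+1) (C b) := fun b =>
    (((hKs b).prod (he b)).mono le_rfl (image_mono (prod_mono le_rfl (subset_univ _)))).union
      (SmallSet.singleton j _)
  have hV : ∀ b, ∃ V : Set Y, IsOpen V ∧ b ∈ V ∧ ∀ y ∈ V, 𝒦 y ⊆ 𝒦 b ∧ C b ⊆ Γ y := by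
    intro b
    obtain ⟨u, v, hu, hv, hbu, hCv, huv⟩ := generalized_tube_lemma (isCompact_singleton (x := b))
      (hCc b) hΓ (by rintro ⟨y, x⟩ ⟨hy, hx⟩; obtain rfl : y = b := hy; exact hCΓ _ hx)
    have h1 : ∀ᶠ y in 𝓝 b, y ∈ u := hu.mem_nhds (hbu rfl)
    obtain ⟨V, hV, hVo, hbV⟩ := eventually_nhds_iff.1 (h1.and (hKu b))
    refine ⟨V, hVo, hbV, fun y hy => ⟨(hV y hy).2, fun x hx => ?_⟩⟩
    exact huv (⟨(hV y hy).1, hCv hx⟩ : (y, x) ∈ u ×ˢ v)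
  choose V hVo hbV hV using hV
  obtain ⟨V1, hV1o, hV1c, hV1f, hV1s⟩ := precise_refinement V hVo
    (eq_univ_of_forall fun y => mem_iUnion.2 ⟨y, hbV y⟩)
  obtain ⟨V', hV'c, hV'o, hV's⟩ := exists_iUnion_eq_closure_subset hV1o
    (fun x => hV1f.point_finite x) hV1c
  have hclf : LocallyFinite fun b => closure (V' b) := hV1f.subset hV's
  have hfin : ∀ y, {b | y ∈ closure (V' b)}.Finite := fun y => hclf.point_finite y
  have hb : ∀ y, ∃ b, y ∈ V' b := fun y => by
    have : y ∈ ⋃ b, V' b := hV'c ▸ mem_univ y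
    exact mem_iUnion.1 this
  choose b hb using hb
  refine ⟨fun y => 𝒦 y ∪ ⋃ b ∈ {b | y ∈ closure (V' b)}, C b, fun y => O y ∩ V' (b y),
    ?_, ?_, ?_, ?_, ?_, ?_, ?_⟩
  · exact fun y => (hKc y).union ((hfin y).isCompact_biUnion fun b _ => hCc b)
  · exact fun y => ((hKs y).mono (Nat.le_succ j) le_rfl).union
      (SmallSet.biUnion (hfin y).countable fun b _ => hCs b)
  · intro y
    refine union_subset (hKΓ y) (iUnion₂_subset fun b hb => ?_)
    exact (hV b y (hV1s _ (hV's _ hb))).2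
  · intro y
    filter_upwards [hKu y, hclf.eventually_subset (fun _ => isClosed_closure) y] with y' h1 h2
    exact union_subset_union h1 (biUnion_subset_biUnion_left h2)
  · exact fun y => (hO y).inter (hV'o _)
  · exact fun y => ⟨hyO y, hb y⟩
  · intro l β hlc hl hlO hβ
    obtain ⟨φ, hφc, hφK⟩ := hφ l β hlc hl (fun j y h => (hlO j y h).1) hβ
    have hmemV : ∀ y, 0 < l j y → y ∈ V' (b (β j y)) := fun y h => (hlO j y h).2
    refine ⟨fun y => e (b (β j y)) (φ y, l j y), ?_, ?_⟩
    · rw [continuous_iff_continuousAt]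
      intro y
      rcases (hl j y).1.eq_or_lt with h0 | h0
      · have key : ∀ W ∈ 𝓝 (φ y), ∀ᶠ y' in 𝓝 y, e (b (β j y')) (φ y', l j y') ∈ W := by
          intro W hW
          obtain ⟨N, hN, hNf⟩ := hclf y
          have h2 : ∀ᶠ y' in 𝓝 y, ∀ c ∈ {c | (closure (V' c) ∩ N).Nonempty},
              e c (φ y', l j y') ∈ W := by
            refine (Filter.eventually_all_finite hNf).2 fun c _ => ?_
            have : ContinuousAt (fun y' => e c (φ y', l j y')) y :=
              ((he c).continuous.comp (hφc.prodMk (hlc j))).continuousAt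
            refine this ?_
            simp only [← h0, he0]
            exact hW
          filter_upwards [h2, hN, hφc.continuousAt hW] with y' h2 hy' h3
          rcases (hl j y').1.eq_or_lt with h | h
          · rw [← h, he0]; exact h3
          · exact h2 _ ⟨y', subset_closure (hmemV y' h), hy'⟩
        intro W hW
        simp only [← h0, he0] at hW
        exact key W hW
      · have : ContinuousAt (fun y' => e (b (β j y)) (φ y', l j y')) y :=
          ((he _).continuous.comp (hφc.prodMk (hlc j))).continuousAt
        refine this.congr ?_
        filter_upwards [hβ j y h0] with y' h
        rw [h]
    · rintro y ⟨i, hi, hiy⟩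
      rcases (hl j y).1.eq_or_lt with h | h
      · have hij : i < j := by
          refine lt_of_le_of_ne (Nat.lt_succ_iff.1 hi) ?_
          rintro rfl
          rw [hiy] at h; exact zero_ne_one h
        simp only [← h, he0]
        exact Or.inl (hφK y ⟨i, hij, hiy⟩)
      · refine Or.inr ?_
        have hm := hmemV y h
        simp only [mem_iUnion]
        refine ⟨b (β j y), subset_closure hm, ?_⟩
        rcases (Nat.lt_succ_iff.1 hi).eq_or_lt with rfl | hij
        · right
          simp [hiy, he1]
        · left
          exact ⟨_, ⟨(hV _ y (hV1s _ (hV's _ (subset_closure hm)))).1 (hφK y ⟨i, hij, hiy⟩), hl j y⟩, rfl⟩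

theorem selection {Y E : Type*} [TopologicalSpace Y] [T2Space Y] [ParacompactSpace Y]
    [PseudoMetricSpace E] [Inhabited E] {m : ℕ} (hY : CovDimLE Y m)
    (Γ : Y → Set E) (hΓ : IsOpen {p : Y × E | p.2 ∈ Γ p.1})
    (hcone : ∀ y, ∀ K : Set E, IsCompact K → K ⊆ Γ y → SmallSet m K →
      ∃ (e : E × ℝ → E) (z : E), LocallyLipschitz e ∧ (∀ k, e (k, 0) = k) ∧ (∀ k, e (k, 1) = z) ∧
        z ∈ Γ y ∧ ∀ k ∈ K, ∀ s ∈ Icc (0:ℝ) 1, e (k, s) ∈ Γ y) :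
    ∃ φ : Y → E, Continuous φ ∧ ∀ y, φ y ∈ Γ y := by
  have main : ∀ j, j ≤ m + 1 → ∃ (𝒦 : Y → Set E) (O : Y → Set Y), (∀ y, IsCompact (𝒦 y)) ∧
    (∀ y, SmallSet j (𝒦 y)) ∧
    (∀ y, 𝒦 y ⊆ Γ y) ∧ (∀ y, ∀ᶠ y' in 𝓝 y, 𝒦 y' ⊆ 𝒦 y) ∧
    (∀ y, IsOpen (O y)) ∧ (∀ y, y ∈ O y) ∧
    (∀ (l : ℕ → Y → ℝ) (β : ℕ → Y → Y), (∀ j, Continuous (l j)) → (∀ j y, l j y ∈ Icc (0:ℝ) 1) →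
      (∀ j y, 0 < l j y → y ∈ O (β j y)) → (∀ j y, 0 < l j y → ∀ᶠ y' in 𝓝 y, β j y' = β j y) →
      ∃ φ : Y → E, Continuous φ ∧ ∀ y, (∃ i < j, l i y = 1) → φ y ∈ 𝒦 y) := by
    intro j
    induction j with
    | zero =>
      intro _
      refine ⟨fun _ => ∅, fun _ => univ, fun _ => isCompact_empty, fun _ => SmallSet.empty _,
        fun _ => empty_subset _, fun _ => by simp, fun _ => isOpen_univ, fun _ => mem_univ _, ?_⟩
      intro _ _ _ _ _ _
      exact ⟨fun _ => default, continuous_const, by simp⟩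
    | succ j ih =>
      intro hj
      obtain ⟨𝒦, O, h1, h2, h3, h4, h5, h6, h7⟩ := ih (by omega)
      exact selection_step Γ hΓ (fun y K hK hKΓ hs => hcone y K hK hKΓ (hs.mono (by omega) le_rfl))
        𝒦 O h1 h2 h3 h4 h5 h6 h7
  obtain ⟨𝒦, O, h1, h2, h3, h4, h5, h6, h7⟩ := main (m+1) le_rfl
  obtain ⟨l, β, hlc, hl, hlO, hβ, hex⟩ := layers_of_dim hY O h5
    (eq_univ_of_forall fun y => mem_iUnion.2 ⟨y, h6 y⟩)
  obtain ⟨φ, hφ, hφK⟩ := h7 l β hlc hl hlO hβ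
  exact ⟨φ, hφ, fun y => h3 y (hφK y (hex y))⟩

def PropO {X Y V : Type*} [TopologicalSpace X] [TopologicalSpace Y] [NormedAddCommGroup V]
    (f : X → Y) (G : Y → Set (BoundedContinuousFunction X V)) : Prop :=
  ∀ y, ∀ u ∈ G y, ∃ δ > 0, ∀ᶠ y' in 𝓝 y, ∀ u' : BoundedContinuousFunction X V,
    (∀ x, f x = y' → dist (u' x) (u x) < δ) → u' ∈ G y'

def PropZ {X Y V : Type*} [TopologicalSpace X] [TopologicalSpace Y] [NormedAddCommGroup V]
    [NormedSpace ℝ V] (m : ℕ)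
    (f : X → Y) (G : Y → Set (BoundedContinuousFunction X V)) : Prop :=
  ∀ y, ∀ K : Set (BoundedContinuousFunction X V), IsCompact K → SmallSet (m+1) K → ∀ δ > 0,
    ∃ R : BoundedContinuousFunction X V → BoundedContinuousFunction X V, LocallyLipschitz R ∧
      ∀ u ∈ K, R u ∈ G y ∧ ∀ x, f x = y → dist (R u x) (u x) < δ

theorem coneMap_lip {E : Type*} [NormedAddCommGroup E] [NormedSpace ℝ E] (g : E) (R : E → E)
    (hR : LocallyLipschitz R) (a b : ℝ → ℝ) (ha : LocallyLipschitz a) (hb : LocallyLipschitz b) :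
    LocallyLipschitz (fun p : E × ℝ => (1 - a p.2) • ((1 - b p.2) • p.1 + b p.2 • g) +
      a p.2 • R ((1 - b p.2) • p.1 + b p.2 • g)) := by
  have h1 : LocallyLipschitz (Prod.fst : E × ℝ → E) := LipschitzWith.prod_fst.locallyLipschitz
  have h2 : LocallyLipschitz (Prod.snd : E × ℝ → ℝ) := LipschitzWith.prod_snd.locallyLipschitz
  have hc : LocallyLipschitz (fun p : E × ℝ => (1 - b p.2) • p.1 + b p.2 • g) := by
    have : ContDiff ℝ 1 (fun q : E × ℝ => (1 - q.2) • q.1 + q.2 • g) := by fun_prop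
    exact this.locallyLipschitz.comp (h1.prodMk (hb.comp h2))
  have h3 : ContDiff ℝ 1 (fun q : (E × E) × ℝ => (1 - q.2) • q.1.1 + q.2 • q.1.2) := by fun_prop
  exact h3.locallyLipschitz.comp ((hc.prodMk (hR.comp hc)).prodMk (ha.comp h2))

theorem one_step {X Y V : Type*} [TopologicalSpace X] [TopologicalSpace Y] [NormedAddCommGroup V]
    [NormedSpace ℝ V] [T2Space Y] [ParacompactSpace Y] {m : ℕ} (hY : CovDimLE Y m)
    (f : X → Y) (hf : Continuous f) (hfc : IsClosedMap f)
    (G : Y → Set (BoundedContinuousFunction X V)) (hO : PropO f G) (hZ : PropZ m f G)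
    (g : BoundedContinuousFunction X V) (ε : Y → ℝ) (hε : Continuous ε) (hε0 : ∀ y, 0 < ε y)
    (M : ℝ) (hM : ∀ y, ε y ≤ M) :
    ∃ g' : BoundedContinuousFunction X V, (∀ x, dist (g' x) (g x) ≤ ε (f x)) ∧ ∀ y, g' ∈ G y := by
  set Γ : Y → Set (BoundedContinuousFunction X V) := fun y =>
    {u | u ∈ G y ∧ ∃ c < ε y, ∀ x, f x = y → dist (u x) (g x) ≤ c} with hΓdef
  have hΓ : IsOpen {p : Y × BoundedContinuousFunction X V | p.2 ∈ Γ p.1} := by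
    rw [isOpen_iff_eventually]
    rintro ⟨y, u⟩ ⟨hu, c, hc, hcu⟩
    obtain ⟨δ, hδ, hev⟩ := hO y u hu
    set η := (ε y - c) / 4 with hη
    have hη0 : 0 < η := by rw [hη]; linarith
    have e1 : ∀ᶠ y' in 𝓝 y, c + 3 * η < ε y' := by
      refine (hε.tendsto y).eventually (lt_mem_nhds ?_)
      rw [hη]; linarith
    have e2 : ∀ᶠ y' in 𝓝 y, ∀ x, f x = y' → dist (u x) (g x) < c + η := by
      have hcl : IsClosed {x | c + η ≤ dist (u x) (g x)} :=
        isClosed_le continuous_const (by fun_prop)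
      have : (f '' {x | c + η ≤ dist (u x) (g x)})ᶜ ∈ 𝓝 y := by
        refine (hfc _ hcl).isOpen_compl.mem_nhds ?_
        rintro ⟨x, hx, hxy⟩
        have := hcu x hxy
        have hx' : c + η ≤ dist (u x) (g x) := hx
        linarith
      filter_upwards [this] with y' hy' x hx
      by_contra h
      exact hy' ⟨x, not_lt.1 h, hx⟩
    have e3 : ∀ᶠ u' in 𝓝 u, dist u' u < min δ η := Metric.ball_mem_nhds u (lt_min hδ hη0)
    have := (hev.and (e1.and e2)).prod_nhds e3
    filter_upwards [this]
    rintro ⟨y', u'⟩ ⟨⟨k1, k2, k3⟩, k4⟩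
    have k5 : ∀ x, dist (u' x) (u x) < min δ η := fun x =>
      (BoundedContinuousFunction.dist_coe_le_dist x).trans_lt k4
    refine ⟨k1 u' fun x _ => (k5 x).trans_le (min_le_left _ _), c + 2 * η, by linarith, ?_⟩
    intro x hx
    have := dist_triangle (u' x) (u x) (g x)
    have h1 := k3 x hx
    have h2 := (k5 x).trans_le (min_le_right _ _)
    linarith
  have hcone : ∀ y, ∀ K : Set (BoundedContinuousFunction X V), IsCompact K → K ⊆ Γ y →
      SmallSet m K →
      ∃ (e : BoundedContinuousFunction X V × ℝ → BoundedContinuousFunction X V)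
        (z : BoundedContinuousFunction X V), LocallyLipschitz e ∧ (∀ k, e (k, 0) = k) ∧
        (∀ k, e (k, 1) = z) ∧
        z ∈ Γ y ∧ ∀ k ∈ K, ∀ s ∈ Icc (0:ℝ) 1, e (k, s) ∈ Γ y := by
    intro y K hK hKΓ hKs
    have huni : ∃ δ > 0, ∀ k ∈ K, (∀ u' : BoundedContinuousFunction X V,
        (∀ x, f x = y → dist (u' x) (k x) < δ) → u' ∈ Γ y) ∧
        ∀ x, f x = y → dist (k x) (g x) + 2 * δ ≤ ε y := by
      refine hK.induction_on (p := fun S => ∃ δ > 0, ∀ k ∈ S,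
        (∀ u' : BoundedContinuousFunction X V,
        (∀ x, f x = y → dist (u' x) (k x) < δ) → u' ∈ Γ y) ∧
        ∀ x, f x = y → dist (k x) (g x) + 2 * δ ≤ ε y) ?_ ?_ ?_ ?_
      · exact ⟨1, one_pos, by simp⟩
      · rintro s t hst ⟨δ, hδ, h⟩
        exact ⟨δ, hδ, fun k hk => h k (hst hk)⟩
      · rintro s t ⟨δ, hδ, h⟩ ⟨δ', hδ', h'⟩
        refine ⟨min δ δ', lt_min hδ hδ', ?_⟩
        rintro k (hk | hk)
        · refine ⟨fun u' hu' => (h k hk).1 u' fun x hx => (hu' x hx).trans_le (min_le_left _ _),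
            fun x hx => ?_⟩
          have := (h k hk).2 x hx
          have := min_le_left δ δ'
          linarith
        · refine ⟨fun u' hu' => (h' k hk).1 u' fun x hx => (hu' x hx).trans_le (min_le_right _ _),
            fun x hx => ?_⟩
          have := (h' k hk).2 x hx
          have := min_le_right δ δ'
          linarith
      · intro k hk
        obtain ⟨hkG, c, hc, hck⟩ := hKΓ hk
        obtain ⟨δ, hδ, hev⟩ := hO y k hkG
        have hev := hev.self_of_nhds
        set η := min δ ((ε y - c) / 4) with hη
        have hη0 : 0 < η := lt_min hδ (by linarith)
        have hη1 : η ≤ δ := min_le_left _ _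
        have hη2 : η ≤ (ε y - c) / 4 := min_le_right _ _
        refine ⟨Metric.ball k (η/2), mem_nhdsWithin_of_mem_nhds (Metric.ball_mem_nhds k (by linarith)),
          η/2, by linarith, ?_⟩
        intro k' hk'
        have hk'' : ∀ x, dist (k' x) (k x) < η / 2 := fun x =>
          (BoundedContinuousFunction.dist_coe_le_dist x).trans_lt hk'
        refine ⟨fun u' hu' => ?_, fun x hx => ?_⟩
        · have h3 : ∀ x, f x = y → dist (u' x) (k x) < η := fun x hx => by
            have := dist_triangle (u' x) (k' x) (k x)
            have := hu' x hx
            have := hk'' x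
            linarith
          refine ⟨hev u' fun x hx => (h3 x hx).trans_le hη1, c + η, by linarith, fun x hx => ?_⟩
          have := dist_triangle (u' x) (k x) (g x)
          have := h3 x hx
          have := hck x hx
          linarith
        · have := dist_triangle (k' x) (k x) (g x)
          have := hk'' x
          have := hck x hx
          linarith
    obtain ⟨δ, hδ, huni⟩ := huni
    have hq : ContDiff ℝ 1 (fun q : BoundedContinuousFunction X V × ℝ =>
      (1 - q.2) • q.1 + q.2 • g) := by fun_prop
    set Kh : Set (BoundedContinuousFunction X V) :=
      (fun q : BoundedContinuousFunction X V × ℝ => (1 - q.2) • q.1 + q.2 • g) '' (K ×ˢ Icc (0:ℝ) 1)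
        ∪ {g} with hKh
    have hKhc : IsCompact Kh :=
      ((hK.prod isCompact_Icc).image hq.continuous).union isCompact_singleton
    have hKhs : SmallSet (m+1) Kh :=
      ((hKs.prod hq.locallyLipschitz).mono le_rfl
        (image_mono (prod_mono le_rfl (subset_univ _)))).union (SmallSet.singleton m _)
    obtain ⟨R, hRl, hR⟩ := hZ y Kh hKhc hKhs (min δ (ε y / 2)) (lt_min hδ (half_pos (hε0 y)))
    set a : ℝ → ℝ := fun s => max 0 (min 1 (2 * s)) with ha
    set b : ℝ → ℝ := fun s => max 0 (min 1 (2 * s - 1)) with hb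
    have hal : LocallyLipschitz a := by
      have : ContDiff ℝ 1 (fun s : ℝ => 2 * s) := by fun_prop
      exact (LocallyLipschitz.const 0).max ((LocallyLipschitz.const 1).min this.locallyLipschitz)
    have hbl : LocallyLipschitz b := by
      have : ContDiff ℝ 1 (fun s : ℝ => 2 * s - 1) := by fun_prop
      exact (LocallyLipschitz.const 0).max ((LocallyLipschitz.const 1).min this.locallyLipschitz)
    refine ⟨_, R g, coneMap_lip g R hRl a b hal hbl, ?_, ?_, ?_, ?_⟩
    · intro k
      simp [ha, hb]
    · intro k
      have h1 : a 1 = 1 := by norm_num [ha]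
      have h2 : b 1 = 1 := by norm_num [hb]
      simp [h1, h2]
    · obtain ⟨h1, h2⟩ := hR g (Or.inr rfl)
      exact ⟨h1, ε y / 2, half_lt_self (hε0 y), fun x hx => ((h2 x hx).trans_le (min_le_right _ _)).le⟩
    · intro k hk s hs
      rcases le_total s (1/2) with h | h
      · have h2 : b s = 0 := by
          rw [hb]; exact max_eq_left ((min_le_right _ _).trans (by linarith))
        have h1 : a s ∈ Icc (0:ℝ) 1 := ⟨le_max_left _ _, max_le zero_le_one (min_le_left _ _)⟩
        simp only [h2, sub_zero, one_smul, zero_smul, add_zero]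
        refine (huni k hk).1 _ fun x hx => ?_
        have hk' : k ∈ Kh := Or.inl ⟨(k, 0), ⟨hk, by simp⟩, by simp⟩
        have := (hR k hk').2 x hx
        have this := this.trans_le (min_le_left _ _)
        rw [dist_eq_norm] at this ⊢
        simp only [BoundedContinuousFunction.coe_add, BoundedContinuousFunction.coe_smul,
          Pi.add_apply]
        have e : (1 - a s) • k x + a s • R k x - k x = a s • (R k x - k x) := by module
        rw [e, norm_smul, Real.norm_of_nonneg h1.1]
        exact (mul_le_of_le_one_left (norm_nonneg _) h1.2).trans_lt this
      · have h1 : a s = 1 := by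
          have : (1:ℝ) ≤ 2 * s := by linarith
          simp [ha, min_eq_left this]
        have h2 : b s ∈ Icc (0:ℝ) 1 := ⟨le_max_left _ _, max_le zero_le_one (min_le_left _ _)⟩
        simp only [h1, sub_self, zero_smul, one_smul, zero_add]
        set c := (1 - b s) • k + b s • g with hc
        have hcK : c ∈ Kh := Or.inl ⟨(k, b s), ⟨hk, h2⟩, rfl⟩
        refine ⟨(hR c hcK).1, ε y - δ, by linarith, fun x hx => ?_⟩
        have h3 := ((hR c hcK).2 x hx).trans_le (min_le_left _ _)
        have h4 : dist (c x) (g x) ≤ dist (k x) (g x) := by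
          rw [dist_eq_norm, dist_eq_norm]
          have e : c x - g x = (1 - b s) • (k x - g x) := by
            simp only [hc, BoundedContinuousFunction.coe_add, BoundedContinuousFunction.coe_smul,
              Pi.add_apply]
            module
          rw [e, norm_smul, Real.norm_of_nonneg (by linarith [h2.2])]
          exact mul_le_of_le_one_left (norm_nonneg _) (by linarith [h2.1])
        have := (huni k hk).2 x hx
        have := dist_triangle (R c x) (c x) (g x)
        linarith
  have : Inhabited (BoundedContinuousFunction X V) := ⟨0⟩
  obtain ⟨φ, hφc, hφ⟩ := selection hY Γ hΓ hcone
  have hd : ∀ x, dist (φ (f x) x) (g x) ≤ ε (f x) := fun x => by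
    obtain ⟨-, c, hc, h⟩ := hφ (f x)
    exact (h x rfl).trans hc.le
  have hcont : Continuous fun x => φ (f x) x :=
    (hφc.comp hf).eval continuous_id
  let g' : BoundedContinuousFunction X V := BoundedContinuousFunction.ofNormedAddCommGroup
    (fun x => φ (f x) x) hcont (M + ‖g‖) (fun x => by
      have h1 := (hd x).trans (hM _)
      rw [dist_eq_norm] at h1
      have h2 := norm_le_norm_sub_add (φ (f x) x) (g x)
      have h3 := g.norm_coe_le_norm x
      linarith)
  refine ⟨g', hd, fun y => ?_⟩
  obtain ⟨δ, hδ, hev⟩ := hO y (φ y) (hφ y).1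
  refine hev.self_of_nhds g' fun x hx => ?_
  have : g' x = φ y x := by rw [← hx]; rfl
  rw [this, dist_self]
  exact hδ

theorem baire_step {X Y V : Type*} [TopologicalSpace X] [TopologicalSpace Y] [NormedAddCommGroup V]
    [NormedSpace ℝ V] [T2Space Y] [ParacompactSpace Y] {m : ℕ} (hY : CovDimLE Y m)
    (f : X → Y) (hf : Continuous f) (hfc : IsClosedMap f)
    (G : Y → Set (BoundedContinuousFunction X V)) (hO : PropO f G) (hZ : PropZ m f G)
    (g : BoundedContinuousFunction X V) (ε : Y → ℝ) (hε : Continuous ε) (hε0 : ∀ y, 0 < ε y)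
    (M : ℝ) (hM : ∀ y, ε y ≤ M) :
    ∃ (g' : BoundedContinuousFunction X V) (ε' : Y → ℝ),
      (∀ x, dist (g' x) (g x) ≤ ε (f x) / 4) ∧ Continuous ε' ∧ (∀ y, 0 < ε' y) ∧
      (∀ y, ε' y ≤ ε y / 4) ∧ ∀ y, ∀ u' : BoundedContinuousFunction X V,
        (∀ x, f x = y → dist (u' x) (g' x) ≤ ε' y) → u' ∈ G y := by
  obtain ⟨g', h1, h2⟩ := one_step hY f hf hfc G hO hZ g (fun y => ε y / 4) (by fun_prop)
    (fun y => by have := hε0 y; positivity) (M / 4) (fun y => by have := hM y; linarith)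
  obtain ⟨ε', hε'⟩ := exists_continuous_forall_mem_convex_of_local_const
    (t := fun y => {c : ℝ | 0 < c ∧ c ≤ ε y / 4 ∧ ∀ u' : BoundedContinuousFunction X V,
        (∀ x, f x = y → dist (u' x) (g' x) ≤ c) → u' ∈ G y}) (by
      intro y
      refine OrdConnected.convex ⟨?_⟩
      rintro a ha b hb c ⟨hac, hcb⟩
      exact ⟨ha.1.trans_le hac, hcb.trans hb.2.1, fun u' hu' =>
        hb.2.2 u' fun x hx => (hu' x hx).trans hcb⟩) (by
      intro y
      obtain ⟨δ, hδ, hev⟩ := hO y g' (h2 y)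
      have hy := hε0 y
      refine ⟨min (δ / 2) (ε y / 8), ?_⟩
      have : ∀ᶠ y' in 𝓝 y, ε y / 2 < ε y' :=
        (hε.tendsto y).eventually (lt_mem_nhds (by linarith))
      filter_upwards [hev, this] with y' k1 k2
      refine ⟨lt_min (by positivity) (by positivity), (min_le_right _ _).trans (by linarith),
        fun u' hu' => k1 u' fun x hx => ?_⟩
      have := (hu' x hx).trans (min_le_left _ _)
      linarith)
  exact ⟨g', ε', h1, ε'.continuous, fun y => (hε' y).1, fun y => (hε' y).2.1, fun y => (hε' y).2.2⟩

theorem baire {X Y V : Type*} [TopologicalSpace X] [TopologicalSpace Y] [NormedAddCommGroup V]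
    [NormedSpace ℝ V] [CompleteSpace V] [T2Space Y] [ParacompactSpace Y] {m : ℕ} (hY : CovDimLE Y m)
    (f : X → Y) (hf : Continuous f) (hfc : IsClosedMap f)
    (G : ℕ → Y → Set (BoundedContinuousFunction X V)) (hO : ∀ i, PropO f (G i))
    (hZ : ∀ i, PropZ m f (G i))
    (g : BoundedContinuousFunction X V) (ε : ℝ) (hε : 0 < ε) :
    ∃ g' : BoundedContinuousFunction X V, (∀ x, dist (g' x) (g x) ≤ ε) ∧ ∀ i y, g' ∈ G i y := by
  let St := {s : BoundedContinuousFunction X V × (Y → ℝ) // Continuous s.2 ∧ (∀ y, 0 < s.2 y) ∧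
    ∀ y, s.2 y ≤ ε}
  have step : ∀ (i : ℕ) (s : St), ∃ s' : St, (∀ x, dist (s'.1.1 x) (s.1.1 x) ≤ s.1.2 (f x) / 4) ∧
      (∀ y, s'.1.2 y ≤ s.1.2 y / 4) ∧ ∀ y, ∀ u' : BoundedContinuousFunction X V,
        (∀ x, f x = y → dist (u' x) (s'.1.1 x) ≤ s'.1.2 y) → u' ∈ G i y := by
    rintro i ⟨⟨g, e⟩, h1, h2, h3⟩
    obtain ⟨g', e', k1, k2, k3, k4, k5⟩ := baire_step hY f hf hfc (G i) (hO i) (hZ i) g e h1 h2 ε h3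
    refine ⟨⟨⟨g', e'⟩, k2, k3, fun y => ?_⟩, k1, k4, k5⟩
    have := h2 y
    have := k4 y
    have := h3 y
    simp only at *
    linarith
  choose nxt n1 n2 n3 using step
  let s : ℕ → St := fun i => Nat.rec ⟨⟨g, fun _ => ε⟩, continuous_const, fun _ => hε, fun _ => le_rfl⟩
    (fun i s => nxt i s) i
  have s1 : ∀ i x, dist ((s (i+1)).1.1 x) ((s i).1.1 x) ≤ (s i).1.2 (f x) / 4 := fun i => n1 i (s i)
  have s2 : ∀ i y, (s (i+1)).1.2 y ≤ (s i).1.2 y / 4 := fun i => n2 i (s i)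
  have s3 : ∀ i y, ∀ u' : BoundedContinuousFunction X V,
        (∀ x, f x = y → dist (u' x) ((s (i+1)).1.1 x) ≤ (s (i+1)).1.2 y) → u' ∈ G i y :=
    fun i => n3 i (s i)
  have s4 : ∀ i y, (s i).1.2 y ≤ ε * (1/4) ^ i := by
    intro i y
    induction i with
    | zero => simp [s]
    | succ i ih =>
      have := s2 i y
      rw [pow_succ]
      linarith
  have s5 : ∀ k i x, dist ((s (i+k)).1.1 x) ((s i).1.1 x) ≤ (s i).1.2 (f x) / 2 := by
    intro k
    induction k with
    | zero =>
      intro i x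
      have := (s i).2.2.1 (f x)
      simp only [add_zero, dist_self]; exact (half_pos this).le
    | succ k ih =>
      intro i x
      have h1 := ih (i+1) x
      have h2 := s1 i x
      have h3 := s2 i (f x)
      have h4 := (s i).2.2.1 (f x)
      have h5 := dist_triangle ((s (i+(k+1))).1.1 x) ((s (i+1)).1.1 x) ((s i).1.1 x)
      rw [show i + 1 + k = i + (k+1) by ring] at h1
      linarith
  have hC : CauchySeq fun i => (s i).1.1 := by
    refine cauchySeq_of_le_geometric (1/4) ε (by norm_num) fun i => ?_
    rw [BoundedContinuousFunction.dist_le (by positivity)]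
    intro x
    rw [dist_comm]
    have h1 := s1 i x
    have h2 := s4 i (f x)
    have h4 := (s i).2.2.1 (f x)
    linarith
  obtain ⟨L, hL⟩ := cauchySeq_tendsto_of_complete hC
  have hL' : ∀ i x, dist (L x) ((s i).1.1 x) ≤ (s i).1.2 (f x) / 2 := by
    intro i x
    have h1 : Filter.Tendsto (fun k => (s k).1.1 x) Filter.atTop (𝓝 (L x)) :=
      ((continuous_eval_const x).tendsto L).comp hL
    have h2 : Filter.Tendsto (fun k => dist ((s k).1.1 x) ((s i).1.1 x)) Filter.atTop
      (𝓝 (dist (L x) ((s i).1.1 x))) := h1.dist tendsto_const_nhds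
    refine le_of_tendsto h2 (Filter.eventually_atTop.2 ⟨i, fun k hk => ?_⟩)
    obtain ⟨j, rfl⟩ := Nat.exists_eq_add_of_le hk
    exact s5 j i x
  refine ⟨L, fun x => ?_, fun i y => s3 i y L fun x hx => ?_⟩
  · have : dist (L x) (g x) ≤ ε / 2 := hL' 0 x
    linarith
  · have := hL' (i+1) x
    have h4 := (s (i+1)).2.2.1 (f x)
    rw [hx] at this h4
    linarith

theorem locLip_add {A F : Type*} [PseudoMetricSpace A] [NormedAddCommGroup F] [NormedSpace ℝ F]
    {u v : A → F} (hu : LocallyLipschitz u) (hv : LocallyLipschitz v) :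
    LocallyLipschitz (fun a => u a + v a) := by
  have : ContDiff ℝ 1 (fun q : F × F => q.1 + q.2) := by fun_prop
  exact this.locallyLipschitz.comp (hu.prodMk hv)

theorem locLip_sub {A F : Type*} [PseudoMetricSpace A] [NormedAddCommGroup F] [NormedSpace ℝ F]
    {u v : A → F} (hu : LocallyLipschitz u) (hv : LocallyLipschitz v) :
    LocallyLipschitz (fun a => u a - v a) := by
  have : ContDiff ℝ 1 (fun q : F × F => q.1 - q.2) := by fun_prop
  exact this.locallyLipschitz.comp (hu.prodMk hv)

theorem locLip_smul {A F : Type*} [PseudoMetricSpace A] [NormedAddCommGroup F] [NormedSpace ℝ F]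
    {u : A → ℝ} {v : A → F} (hu : LocallyLipschitz u) (hv : LocallyLipschitz v) :
    LocallyLipschitz (fun a => u a • v a) := by
  have : ContDiff ℝ 1 (fun q : ℝ × F => q.1 • q.2) := by fun_prop
  exact this.locallyLipschitz.comp (hu.prodMk hv)

theorem locLip_sum {A F ι : Type*} [PseudoMetricSpace A] [NormedAddCommGroup F] [NormedSpace ℝ F]
    (s : Finset ι) {u : ι → A → F} (hu : ∀ i ∈ s, LocallyLipschitz (u i)) :
    LocallyLipschitz (fun a => ∑ i ∈ s, u i a) := by
  classical
  induction s using Finset.induction_on with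
  | empty => simpa using LocallyLipschitz.const (0:F)
  | insert i s hi ih =>
    simp only [Finset.sum_insert hi]
    exact locLip_add (hu i (Finset.mem_insert_self _ _))
      (ih fun j hj => hu j (Finset.mem_insert_of_mem hj))

/-- general position -/
theorem general_position {F : Type*} [NormedAddCommGroup F] [NormedSpace ℝ F]
    [FiniteDimensional ℝ F] (m D : ℕ) (hD : D + m < Module.finrank ℝ F)
    (S : Set (Σ d : ℕ, ((Fin d → ℝ) → ℕ → F))) (hS : S.Countable)
    (hSl : ∀ s ∈ S, s.1 < m + 1 ∧ ∀ i, LocallyLipschitz (fun t => s.2 t i))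
    (ε : ℝ) (hε : 0 < ε) (N : ℕ) :
    ∃ w : ℕ → F, w 0 = 0 ∧ (∀ i, ‖w i‖ < ε) ∧ ∀ k < N, ∀ s ∈ S, ∀ t, ∀ i0 < k,
      ∀ τ : Finset ℕ, τ ⊆ Finset.range k → τ.card ≤ D → ∀ c : ℕ → ℝ,
      s.2 t k + w k ≠ (s.2 t i0 + w i0) + ∑ i ∈ τ, c i • ((s.2 t i + w i) - (s.2 t i0 + w i0)) := by
  classical
  induction N with
  | zero => exact ⟨fun _ => 0, rfl, fun _ => by simpa using hε, by simp⟩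
  | succ N ih =>
    obtain ⟨w, hw0, hw, hk⟩ := ih
    rcases Nat.eq_zero_or_pos N with rfl | hN
    · refine ⟨fun _ => 0, rfl, fun _ => by simpa using hε, ?_⟩
      intro k hk s hs t i0 hi0
      omega
    -- the bad set
    let Φ : (s : Σ d : ℕ, ((Fin d → ℝ) → ℕ → F)) → (q : ℕ × Finset ℕ) →
        ((q.2 → ℝ) × (Fin s.1 → ℝ)) → F := fun s q a =>
      (s.2 a.2 q.1 + w q.1) + ∑ i : q.2, a.1 i • ((s.2 a.2 i + w i) - (s.2 a.2 q.1 + w q.1))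
        - s.2 a.2 N
    let T : Set (ℕ × Finset ℕ) := {q | q.2.card ≤ D}
    let B : Set F := ⋃ s ∈ S, ⋃ q ∈ T, range (Φ s q)
    have hB : dimH B < Module.finrank ℝ F := by
      have : dimH B ≤ ((D + m : ℕ) : ENNReal) := by
        rw [dimH_bUnion hS]
        refine iSup₂_le fun s hs => ?_
        rw [dimH_bUnion (to_countable T)]
        refine iSup₂_le fun q hq => ?_
        have hl : LocallyLipschitz (Φ s q) := by
          have h2 : LocallyLipschitz (Prod.snd : (q.2 → ℝ) × (Fin s.1 → ℝ) → (Fin s.1 → ℝ)) :=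
            LipschitzWith.prod_snd.locallyLipschitz
          have hb : ∀ i, LocallyLipschitz (fun a : (q.2 → ℝ) × (Fin s.1 → ℝ) => s.2 a.2 i) :=
            fun i => ((hSl s hs).2 i).comp h2
          have hbw : ∀ i, LocallyLipschitz
              (fun a : (q.2 → ℝ) × (Fin s.1 → ℝ) => s.2 a.2 i + w i) :=
            fun i => locLip_add (hb i) (LocallyLipschitz.const _)
          refine locLip_sub (locLip_add (hbw _) (locLip_sum _ fun i _ => locLip_smul ?_
            (locLip_sub (hbw _) (hbw _)))) (hb _)
          have : ContDiff ℝ 1 (fun a : (q.2 → ℝ) × (Fin s.1 → ℝ) => a.1 i) := by fun_prop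
          exact this.locallyLipschitz
        have h1 := dimH_range_le_of_locally_lipschitzOn (f := Φ s q) (fun x => by
          obtain ⟨K, t, ht, h⟩ := hl x
          exact ⟨K, t, ht, h⟩)
        rw [Real.dimH_univ_eq_finrank] at h1
        refine h1.trans ?_
        rw [Module.finrank_prod, Module.finrank_fintype_fun_eq_card,
          Module.finrank_fintype_fun_eq_card]
        have h3 : q.2.card ≤ D := hq
        have h4 := (hSl s hs).1
        simp only [Fintype.card_coe, Fintype.card_fin]
        exact_mod_cast (by omega : q.2.card + s.1 ≤ D + m)
      exact this.trans_lt (by exact_mod_cast hD)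
    obtain ⟨v, hvB, hv⟩ := (dense_compl_of_dimH_lt_finrank hB).exists_dist_lt (0:F) hε
    refine ⟨Function.update w N v, ?_, ?_, ?_⟩
    · rw [Function.update_of_ne (by omega)]; exact hw0
    · intro i
      by_cases h : i = N
      · subst h; simpa using hv
      · rw [Function.update_of_ne h]; exact hw i
    · intro k hkN s hs t i0 hi0 τ hτ hτD c
      have hne : ∀ i ∈ τ, i ≠ N := fun i hi => by
        have := Finset.mem_range.1 (hτ hi); omega
      have hi0N : i0 ≠ N := by omega
      have hsum : ∑ i ∈ τ, c i • ((s.2 t i + Function.update w N v i) -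
          (s.2 t i0 + Function.update w N v i0)) =
          ∑ i ∈ τ, c i • ((s.2 t i + w i) - (s.2 t i0 + w i0)) := by
        refine Finset.sum_congr rfl fun i hi => ?_
        rw [Function.update_of_ne (hne i hi), Function.update_of_ne hi0N]
      rw [hsum, Function.update_of_ne hi0N]
      rcases (Nat.lt_succ_iff.1 hkN).eq_or_lt with rfl | hlt
      · rw [Function.update_self]
        intro heq
        refine hvB ?_
        simp only [B, mem_iUnion]
        refine ⟨s, hs, (i0, τ), hτD, (fun i => c i, t), ?_⟩
        simp only [Φ]
        rw [Finset.sum_coe_sort τ (fun i => c i • ((s.2 t i + w i) - (s.2 t i0 + w i0))), ← heq]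
        abel
      · rw [Function.update_of_ne (by omega)]
        exact hk k hlt s hs t i0 hi0 τ hτ hτD c

theorem affine_indep_of_gp {F : Type*} [NormedAddCommGroup F] [NormedSpace ℝ F] {N D : ℕ}
    (v : ℕ → F) (hv : ∀ k < N, ∀ i0 < k, ∀ τ : Finset ℕ, τ ⊆ Finset.range k → τ.card ≤ D →
      ∀ c : ℕ → ℝ, v k ≠ v i0 + ∑ i ∈ τ, c i • (v i - v i0))
    (c : Fin N → ℝ) (hc : ∑ i, c i = 0) (hcard : (Finset.univ.filter fun i => c i ≠ 0).card ≤ D + 2)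
    (h0 : ∑ i, c i • v i = 0) : c = 0 := by
  classical
  by_contra hne
  set ρ := Finset.univ.filter fun i => c i ≠ 0 with hρ
  have hρne : ρ.Nonempty := by
    by_contra h
    rw [Finset.not_nonempty_iff_eq_empty, Finset.filter_eq_empty_iff] at h
    exact hne (funext fun i => by simpa using h (Finset.mem_univ i))
  set k := ρ.max' hρne with hk
  have hkρ : k ∈ ρ := ρ.max'_mem hρne
  have hck : c k ≠ 0 := (Finset.mem_filter.1 hkρ).2
  have hsρ : ∑ i ∈ ρ, c i = 0 := by
    rw [← hc]; exact Finset.sum_filter_ne_zero _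
  have hsk : c k + ∑ i ∈ ρ.erase k, c i = 0 := by
    rw [Finset.add_sum_erase _ _ hkρ, hsρ]
  have hne2 : (ρ.erase k).Nonempty := by
    by_contra h
    rw [Finset.not_nonempty_iff_eq_empty] at h
    rw [h] at hsk; simp at hsk; exact hck hsk
  obtain ⟨i0, hi0⟩ := hne2
  have hlt : ∀ i ∈ ρ.erase k, i < k := fun i hi =>
    lt_of_le_of_ne (ρ.le_max' i (Finset.mem_of_mem_erase hi)) (Finset.ne_of_mem_erase hi)
  have hvs : ∑ i ∈ ρ, c i • (v i - v i0) = 0 := by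
    simp only [smul_sub, Finset.sum_sub_distrib, ← Finset.sum_smul, hsρ, zero_smul, sub_zero]
    rw [← h0]
    refine Finset.sum_subset (Finset.subset_univ _) fun i _ hi => ?_
    have : c i = 0 := by simpa [hρ] using hi
    simp [this]
  have hvs2 : c k • (v k - v i0) + ∑ i ∈ (ρ.erase k).erase i0, c i • (v i - v i0) = 0 := by
    rw [← hvs, ← Finset.add_sum_erase _ _ hkρ, ← Finset.add_sum_erase _ _ hi0]
    simp
  refine hv k k.2 i0 (hlt i0 hi0) (((ρ.erase k).erase i0).map Fin.valEmbedding) ?_ ?_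
    (fun i => if h : i < N then - c ⟨i, h⟩ / c k else 0) ?_
  · intro i hi
    obtain ⟨j, hj, rfl⟩ := Finset.mem_map.1 hi
    exact Finset.mem_range.2 (hlt j (Finset.mem_of_mem_erase hj))
  · rw [Finset.card_map, Finset.card_erase_of_mem hi0, Finset.card_erase_of_mem hkρ]
    omega
  · rw [Finset.sum_map]
    simp only [Fin.valEmbedding_apply, Fin.is_lt, dite_true, Fin.eta]
    have : v k - v i0 = ∑ i ∈ (ρ.erase k).erase i0, (- c i / c k) • (v i - v i0) := by
      have h1 : c k • (v k - v i0) = - ∑ i ∈ (ρ.erase k).erase i0, c i • (v i - v i0) :=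
        eq_neg_of_add_eq_zero_left hvs2
      have h2 : v k - v i0 = (c k)⁻¹ • (c k • (v k - v i0)) := by rw [inv_smul_smul₀ hck]
      rw [h2, h1, ← Finset.sum_neg_distrib, Finset.smul_sum]
      refine Finset.sum_congr rfl fun i _ => ?_
      rw [← neg_smul, smul_smul]
      congr 1
      ring
    rw [← this]; abel

theorem lower_bound_of_indep {F : Type*} [NormedAddCommGroup F] [NormedSpace ℝ F] {N D : ℕ}
    (v : Fin N → F)
    (hv : ∀ c : Fin N → ℝ, ∑ i, c i = 0 → (Finset.univ.filter fun i => c i ≠ 0).card ≤ D →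
      ∑ i, c i • v i = 0 → c = 0) :
    ∃ δ > 0, ∀ c : Fin N → ℝ, ∑ i, c i = 0 → ∑ i, |c i| = 2 →
      (Finset.univ.filter fun i => c i ≠ 0).card ≤ D → δ ≤ ‖∑ i, c i • v i‖ := by
  classical
  let T : Set (Finset (Fin N)) := {ρ | ρ.card ≤ D}
  let C : Finset (Fin N) → Set (Fin N → ℝ) := fun ρ =>
    {c | (∀ i, i ∉ ρ → c i = 0) ∧ ∑ i, c i = 0 ∧ ∑ i, |c i| = 2}
  have hCc : ∀ ρ, IsCompact (C ρ) := by
    intro ρ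
    refine Metric.isCompact_of_isClosed_isBounded ?_ ?_
    · refine IsClosed.inter ?_ (IsClosed.inter ?_ ?_)
      · have : {c : Fin N → ℝ | ∀ i, i ∉ ρ → c i = 0} = ⋂ i, ⋂ (_ : i ∉ ρ), {c | c i = 0} := by
          ext c; simp
        change IsClosed {c : Fin N → ℝ | ∀ i, i ∉ ρ → c i = 0}
        rw [this]
        exact isClosed_iInter fun i => isClosed_iInter fun _ =>
          isClosed_eq (continuous_apply i) continuous_const
      · exact isClosed_eq (by fun_prop) continuous_const
      · exact isClosed_eq (by fun_prop) continuous_const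
    · refine (Metric.isBounded_closedBall (x := (0 : Fin N → ℝ)) (r := 2)).subset ?_
      rintro c ⟨-, -, h⟩
      rw [mem_closedBall_zero_iff, pi_norm_le_iff_of_nonneg zero_le_two]
      intro i
      rw [← h, Real.norm_eq_abs]
      exact Finset.single_le_sum (f := fun i => |c i|) (fun i _ => abs_nonneg _) (Finset.mem_univ i)
  have hK : IsCompact (⋃ ρ ∈ T, C ρ) := (Set.toFinite T).isCompact_biUnion fun ρ _ => hCc ρ
  have hmem : ∀ c : Fin N → ℝ, ∑ i, c i = 0 → ∑ i, |c i| = 2 →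
      (Finset.univ.filter fun i => c i ≠ 0).card ≤ D → c ∈ ⋃ ρ ∈ T, C ρ := by
    intro c h1 h2 h3
    simp only [mem_iUnion]
    refine ⟨Finset.univ.filter fun i => c i ≠ 0, h3, ?_, h1, h2⟩
    intro i hi
    simpa using hi
  rcases (⋃ ρ ∈ T, C ρ).eq_empty_or_nonempty with he | hne
  · refine ⟨1, one_pos, fun c h1 h2 h3 => ?_⟩
    have := hmem c h1 h2 h3
    rw [he] at this
    exact this.elim
  · obtain ⟨c0, hc0, hmin⟩ := hK.exists_isMinOn hne
      (f := fun c : Fin N → ℝ => ‖∑ i, c i • v i‖) (by fun_prop)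
    refine ⟨‖∑ i, c0 i • v i‖, ?_, fun c h1 h2 h3 => hmin (hmem c h1 h2 h3)⟩
    rw [gt_iff_lt, norm_pos_iff]
    intro h
    simp only [mem_iUnion] at hc0
    obtain ⟨ρ, hρ, k1, k2, k3⟩ := hc0
    have : c0 = 0 := by
      refine hv c0 k2 (le_trans (Finset.card_le_card ?_) hρ) h
      intro i hi
      by_contra h'
      exact (Finset.mem_filter.1 hi).2 (k1 i h')
    rw [this] at k3
    simp at k3

theorem gp_fin {F : Type*} [NormedAddCommGroup F] [NormedSpace ℝ F]
    [FiniteDimensional ℝ F] (m D : ℕ) (hD : D + m < Module.finrank ℝ F) (N : ℕ)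
    (S : Set (Σ d : ℕ, ((Fin d → ℝ) → Fin N → F))) (hS : S.Countable)
    (hSl : ∀ s ∈ S, s.1 < m + 1 ∧ ∀ i, LocallyLipschitz (fun t => s.2 t i))
    (ε : ℝ) (hε : 0 < ε) :
    ∃ w : Fin N → F, (∀ i, i.val = 0 → w i = 0) ∧ (∀ i, ‖w i‖ < ε) ∧ ∀ s ∈ S, ∀ t,
      ∃ δ > 0, ∀ c : Fin N → ℝ, ∑ i, c i = 0 → ∑ i, |c i| = 2 →
      (Finset.univ.filter fun i => c i ≠ 0).card ≤ D + 2 → δ ≤ ‖∑ i, c i • (s.2 t i + w i)‖ := by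
  obtain ⟨w, hw0, hw, h⟩ := general_position m D hD
    ((fun s : (Σ d : ℕ, ((Fin d → ℝ) → Fin N → F)) =>
      (⟨s.1, fun t i => if h : i < N then s.2 t ⟨i, h⟩ else 0⟩ : Σ d : ℕ, ((Fin d → ℝ) → ℕ → F))) '' S)
    (hS.image _) (by
      rintro _ ⟨s, hs, rfl⟩
      refine ⟨(hSl s hs).1, fun i => ?_⟩
      by_cases h : i < N
      · simp only [h, dite_true]; exact (hSl s hs).2 _
      · simp only [h, dite_false]; exact LocallyLipschitz.const _) ε hε N
  refine ⟨fun i => w i, fun i hi => by simp only [hi, hw0], fun i => hw i, fun s hs t => ?_⟩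
  refine lower_bound_of_indep _ fun c h1 h2 h3 => ?_
  refine affine_indep_of_gp (fun i : ℕ => (if h : i < N then s.2 t ⟨i, h⟩ else 0) + w i) ?_ c h1 h2 ?_
  · intro k hk i0 hi0 τ hτ hτD c
    exact h k hk _ ⟨s, hs, rfl⟩ t i0 hi0 τ hτ hτD c
  · rw [← h3]
    refine Finset.sum_congr rfl fun i _ => ?_
    simp

theorem nerve {X M V : Type*} [TopologicalSpace X] [NormalSpace X] [PseudoMetricSpace M]
    [CompactSpace M] [NormedAddCommGroup V] [NormedSpace ℝ V] [ProperSpace V]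
    (A : Set X) (hA : IsClosed A) (hAne : A.Nonempty) {n : ℕ} (hdim : CovDimLE A n)
    (h : X → M) (hh : Continuous h)
    (K : Set (BoundedContinuousFunction X V)) (hK : IsCompact K) (δ η : ℝ) (hδ : 0 < δ)
    (hη : 0 < η) :
    ∃ (N : ℕ) (μ : Fin N → C(X, ℝ)) (pts : Fin N → X), (∀ i x, 0 ≤ μ i x ∧ μ i x ≤ 1) ∧
      (∀ x ∈ A, ∑ i, μ i x = 1) ∧
      (∀ x ∈ A, (Finset.univ.filter fun i => μ i x ≠ 0).card ≤ n + 1) ∧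
      (∀ x ∈ A, ∀ i, μ i x ≠ 0 → ∀ u ∈ K, dist (u (pts i)) (u x) < δ) ∧
      (∀ x ∈ A, ∀ x' ∈ A, ∀ i, μ i x ≠ 0 → μ i x' ≠ 0 → dist (h x) (h x') < η) := by
  classical
  obtain ⟨t, -, htf, hKt⟩ := hK.finite_cover_balls (show 0 < δ / 4 by positivity)
  have : Finite t := htf
  have : Fintype t := Fintype.ofFinite t
  let Ψ : X → (t → V) × M := fun x => (fun k => k.1 x, h x)
  have hΨ : Continuous Ψ := by
    refine Continuous.prodMk (continuous_pi fun k => k.1.continuous) hh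
  have hb : Bornology.IsBounded (range Ψ) := by
    rw [← Bornology.isBounded_image_fst_and_snd]
    constructor
    · rw [← Bornology.forall_isBounded_image_eval_iff]
      intro k
      refine (k.1.isBounded_range).subset ?_
      rintro _ ⟨_, ⟨_, ⟨x, rfl⟩, rfl⟩, rfl⟩
      exact ⟨x, rfl⟩
    · exact (isCompact_univ (X := M)).isBounded.subset (subset_univ _)
  have hc : IsCompact (closure (range Ψ)) := hb.isCompact_closure
  set r := min (δ / 4) (η / 2) with hr
  have hr0 : 0 < r := lt_min (by positivity) (by positivity)
  obtain ⟨t2, -, ht2f, hcov⟩ := hc.finite_cover_balls hr0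
  have : Finite t2 := ht2f
  set N := Nat.card t2 with hN
  let e : Fin N ≃ t2 := (Finite.equivFin t2).symm
  let U : Fin N → Set X := fun i => Ψ ⁻¹' Metric.ball (e i).1 r
  have hUo : ∀ i, IsOpen (U i) := fun i => Metric.isOpen_ball.preimage hΨ
  have hUc : ∀ x, ∃ i, x ∈ U i := by
    intro x
    have := hcov (subset_closure (mem_range_self x))
    simp only [mem_iUnion] at this
    obtain ⟨p, hp, hx⟩ := this
    exact ⟨e.symm ⟨p, hp⟩, by simpa [U] using hx⟩
  have hUd : ∀ i x x', x ∈ U i → x' ∈ U i → dist (Ψ x) (Ψ x') < 2 * r := by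
    intro i x x' hx hx'
    have := dist_triangle_right (Ψ x) (Ψ x') (e i).1
    have h1 : dist (Ψ x) (e i).1 < r := hx
    have h2 : dist (Ψ x') (e i).1 < r := hx'
    linarith
  have hUK : ∀ i x x', x ∈ U i → x' ∈ U i → ∀ u ∈ K, dist (u x) (u x') < δ := by
    intro i x x' hx hx' u hu
    have := hKt hu
    simp only [mem_iUnion] at this
    obtain ⟨k, hk, huk⟩ := this
    have h1 : dist u k < δ / 4 := huk
    have h2 : ∀ x, dist (u x) (k x) < δ / 4 := fun x =>
      (BoundedContinuousFunction.dist_coe_le_dist x).trans_lt h1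
    have h3 : dist (k x) (k x') < 2 * r := by
      refine lt_of_le_of_lt ?_ (hUd i x x' hx hx')
      refine le_trans ?_ (le_max_left _ _)
      exact dist_le_pi_dist (Ψ x).1 (Ψ x').1 ⟨k, hk⟩
    have h4 := dist_triangle4 (u x) (k x) (k x') (u x')
    have h5 := h2 x
    have h6 := h2 x'
    rw [dist_comm] at h6
    have : r ≤ δ / 4 := min_le_left _ _
    linarith
  have hUh : ∀ i x x', x ∈ U i → x' ∈ U i → dist (h x) (h x') < η := by
    intro i x x' hx hx'
    have h1 : dist (h x) (h x') ≤ dist (Ψ x) (Ψ x') := le_max_right _ _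
    have h2 := hUd i x x' hx hx'
    have : r ≤ η / 2 := min_le_right _ _
    linarith
  obtain ⟨Vv, hVo, hVU, hVc, hVcard⟩ := hdim (Fin N) (fun i => Subtype.val ⁻¹' U i) inferInstance
    (fun i => (hUo i).preimage continuous_subtype_val)
    (eq_univ_of_forall fun x => by
      obtain ⟨i, hi⟩ := hUc x.1
      exact mem_iUnion.2 ⟨i, hi⟩)
  choose W hWo hWV using fun i => isOpen_induced_iff.1 (hVo i)
  obtain ⟨μ, hμ⟩ := PartitionOfUnity.exists_isSubordinate_of_locallyFinite hA W hWo
    (locallyFinite_of_finite W) (by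
      intro x hx
      have : (⟨x, hx⟩ : A) ∈ ⋃ i, Vv i := hVc ▸ mem_univ _
      obtain ⟨i, hi⟩ := mem_iUnion.1 this
      rw [← hWV i] at hi
      exact mem_iUnion.2 ⟨i, hi⟩)
  have hμV : ∀ i x (hx : x ∈ A), μ i x ≠ 0 → (⟨x, hx⟩ : A) ∈ Vv i := by
    intro i x hx hne
    rw [← hWV i]
    exact hμ i (subset_tsupport _ hne)
  obtain ⟨x0, hx0⟩ := hAne
  have hpts : ∀ i, ∃ p : X, ∀ x (hx : x ∈ A), (⟨x, hx⟩ : A) ∈ Vv i → p ∈ U i := by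
    intro i
    by_cases hne : (Vv i).Nonempty
    · obtain ⟨p, hp⟩ := hne
      exact ⟨p.1, fun _ _ _ => hVU i hp⟩
    · exact ⟨x0, fun x hx h => (hne ⟨_, h⟩).elim⟩
  choose pts hpts using hpts
  refine ⟨N, fun i => μ i, pts, fun i x => ⟨μ.nonneg i x, μ.le_one i x⟩, ?_, ?_, ?_, ?_⟩
  · intro x hx
    have := μ.sum_eq_one hx
    rwa [finsum_eq_sum_of_fintype] at this
  · intro x hx
    have h1 := hVcard ⟨x, hx⟩
    have h2 : (Finset.univ.filter fun i => μ i x ≠ 0).card ≤ {i | (⟨x, hx⟩ : A) ∈ Vv i}.ncard := by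
      rw [← Set.ncard_coe_finset]
      refine Set.ncard_le_ncard ?_ (toFinite _)
      intro i hi
      simp only [Finset.coe_filter, Finset.mem_univ, true_and] at hi
      exact hμV i x hx hi
    have : ((Finset.univ.filter fun i => μ i x ≠ 0).card : ℤ) ≤ n + 1 := le_trans (by exact_mod_cast h2) h1
    exact_mod_cast this
  · intro x hx i hi u hu
    exact hUK i _ _ (hpts i x hx (hμV i x hx hi)) (hVU i (hμV i x hx hi)) u hu
  · intro x hx x' hx' i hi hi'
    exact hUh i _ _ (hVU i (hμV i x hx hi)) (hVU i (hμV i x' hx' hi'))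

/-- the piecewise affine approximation operator -/
theorem approx_op {X V : Type*} [TopologicalSpace X] [NormedAddCommGroup V] [NormedSpace ℝ V]
    {N : ℕ} (μ : Fin N → C(X, ℝ)) (hμ : ∀ i x, 0 ≤ μ i x ∧ μ i x ≤ 1) (pts : Fin N → X)
    (w : Fin N → V) :
    ∃ R : BoundedContinuousFunction X V → BoundedContinuousFunction X V, LocallyLipschitz R ∧
      ∀ u x, R u x = ∑ i, μ i x • (u (pts i) + w i) := by
  let R : BoundedContinuousFunction X V → BoundedContinuousFunction X V := fun u =>
    BoundedContinuousFunction.ofNormedAddCommGroup (fun x => ∑ i, μ i x • (u (pts i) + w i))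
      (by fun_prop) (∑ i, ‖u (pts i) + w i‖) (fun x => by
        refine (norm_sum_le _ _).trans (Finset.sum_le_sum fun i _ => ?_)
        rw [norm_smul, Real.norm_of_nonneg (hμ i x).1]
        exact mul_le_of_le_one_left (norm_nonneg _) (hμ i x).2)
  refine ⟨R, ?_, fun u x => rfl⟩
  refine LipschitzWith.locallyLipschitz (K := (N : NNReal)) ?_
  refine LipschitzWith.of_dist_le_mul fun u u' => ?_
  rw [BoundedContinuousFunction.dist_le (by positivity)]
  intro x
  have : R u x - R u' x = ∑ i, μ i x • (u (pts i) - u' (pts i)) := by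
    change ∑ i, μ i x • (u (pts i) + w i) - ∑ i, μ i x • (u' (pts i) + w i) = _
    rw [← Finset.sum_sub_distrib]
    refine Finset.sum_congr rfl fun i _ => ?_
    rw [← smul_sub]; congr 1; abel
  rw [dist_eq_norm, this]
  refine (norm_sum_le _ _).trans ?_
  have h2 : ∀ i ∈ Finset.univ, ‖μ i x • (u (pts i) - u' (pts i))‖ ≤ dist u u' := by
    intro i _
    rw [norm_smul, Real.norm_of_nonneg (hμ i x).1]
    refine (mul_le_of_le_one_left (norm_nonneg _) (hμ i x).2).trans ?_
    rw [← dist_eq_norm]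
    exact BoundedContinuousFunction.dist_coe_le_dist _
  refine (Finset.sum_le_card_nsmul _ _ _ h2).trans ?_
  simp

theorem approx_close {X V : Type*} [TopologicalSpace X] [NormedAddCommGroup V] [NormedSpace ℝ V]
    {N : ℕ} (μ : Fin N → C(X, ℝ)) (hμ : ∀ i x, 0 ≤ μ i x ∧ μ i x ≤ 1) (pts : Fin N → X)
    (w : Fin N → V) (u : X → V) (x : X) (hx : ∑ i, μ i x = 1) (δ : ℝ)
    (hu : ∀ i, μ i x ≠ 0 → dist (u (pts i)) (u x) < δ / 4) (hw : ∀ i, ‖w i‖ < δ / 4) (hδ : 0 < δ) :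
    dist (∑ i, μ i x • (u (pts i) + w i)) (u x) < δ := by
  have e : ∑ i, μ i x • (u (pts i) + w i) - u x = ∑ i, μ i x • (u (pts i) + w i - u x) := by
    simp only [smul_sub, Finset.sum_sub_distrib, ← Finset.sum_smul, hx, one_smul]
  rw [dist_eq_norm, e]
  refine lt_of_le_of_lt (norm_sum_le _ _) ?_
  have h2 : ∀ i ∈ Finset.univ, ‖μ i x • (u (pts i) + w i - u x)‖ ≤ μ i x * (δ / 2) := by
    intro i _
    rw [norm_smul, Real.norm_of_nonneg (hμ i x).1]
    by_cases h0 : μ i x = 0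
    · simp [h0]
    · refine mul_le_mul_of_nonneg_left ?_ (hμ i x).1
      have h3 := hu i h0
      rw [dist_eq_norm] at h3
      have h4 : u (pts i) + w i - u x = (u (pts i) - u x) + w i := by abel
      rw [h4]
      have := norm_add_le (u (pts i) - u x) (w i)
      have := hw i
      linarith
  refine (Finset.sum_le_sum h2).trans_lt ?_
  rw [← Finset.sum_mul, hx]
  linarith

def GP {X Y M V : Type*} [TopologicalSpace X] [PseudoMetricSpace M] [NormedAddCommGroup V]
    (f : X → Y) (h : X → M) (η : ℝ) (y : Y) : Set (BoundedContinuousFunction X V) :=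
  {u | ∃ δ > 0, ∃ η' < η, ∀ x x', f x = y → f x' = y → dist (u x) (u x') < δ →
    dist (h x) (h x') < η'}

def GQ {X Y : Type*} [TopologicalSpace X] {p : ℕ}
    (f : X → Y) (s : Finset (Fin p)) (r : Fin p → ℝ) (y : Y) :
    Set (BoundedContinuousFunction X (EuclideanSpace ℝ (Fin p))) :=
  {u | ∃ δ > 0, ∀ x, f x = y → ∃ i ∈ s, δ ≤ |u x i - r i|}

theorem closed_near {X Y M : Type*} [TopologicalSpace X] [TopologicalSpace Y] [PseudoMetricSpace M]
    (f : X → Y) (hfc : IsClosedMap f) (F : X → M) (hF : Continuous F) (θ : ℝ) (hθ : 0 < θ) (y : Y) :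
    ∀ᶠ y' in 𝓝 y, ∀ x, f x = y' → ∃ x0, f x0 = y ∧ dist (F x) (F x0) < θ := by
  have hU : IsOpen (⋃ x0 ∈ f ⁻¹' {y}, {x | dist (F x) (F x0) < θ}) :=
    isOpen_biUnion fun x0 _ => isOpen_lt (by fun_prop) continuous_const
  have : (f '' (⋃ x0 ∈ f ⁻¹' {y}, {x | dist (F x) (F x0) < θ})ᶜ)ᶜ ∈ 𝓝 y := by
    refine (hfc _ hU.isClosed_compl).isOpen_compl.mem_nhds ?_
    rintro ⟨x, hx, hxy⟩
    refine hx ?_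
    simp only [mem_iUnion]
    exact ⟨x, hxy, by simpa using hθ⟩
  filter_upwards [this] with y' hy' x hx
  by_contra hcon
  refine hy' ⟨x, fun hxU => hcon ?_, hx⟩
  simp only [mem_iUnion] at hxU
  obtain ⟨x0, h0, h1⟩ := hxU
  exact ⟨x0, h0, h1⟩

theorem GP_strong {X Y M V : Type*} [TopologicalSpace X] [TopologicalSpace Y] [PseudoMetricSpace M]
    [NormedAddCommGroup V]
    (f : X → Y) (hfc : IsClosedMap f) (h : X → M) (hh : Continuous h) (η : ℝ) (y : Y)
    (u : BoundedContinuousFunction X V) (hu : u ∈ GP f h η y) :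
    ∃ δ > 0, ∃ η' < η, ∃ W ∈ 𝓝 y, ∀ x x', f x ∈ W → f x' ∈ W → dist (u x) (u x') < δ →
      dist (h x) (h x') < η' := by
  obtain ⟨δ, hδ, η', hη', H⟩ := hu
  set θ := min (δ / 4) ((η - η') / 4) with hθ
  have hθ0 : 0 < θ := lt_min (by positivity) (by linarith)
  have h1 : θ ≤ δ / 4 := min_le_left _ _
  have h2 : θ ≤ (η - η') / 4 := min_le_right _ _
  refine ⟨δ / 4, by positivity, η' + 2 * θ, by linarith, _,
    closed_near f hfc (fun x => (u x, h x)) (by fun_prop) θ hθ0 y, ?_⟩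
  intro x x' hx hx' hd
  obtain ⟨z, hz, hz'⟩ := hx x rfl
  obtain ⟨z2, hz2, hz2'⟩ := hx' x' rfl
  rw [Prod.dist_eq, max_lt_iff] at hz' hz2'
  simp only at hz' hz2'
  have k1 := dist_triangle4 (u z) (u x) (u x') (u z2)
  have k2 := dist_triangle4 (h x) (h z) (h z2) (h x')
  have k3 := H z z2 hz hz2 (by
    rw [dist_comm (u z) (u x)] at k1
    linarith [hz'.1, hz2'.1])
  rw [dist_comm (h z2) (h x')] at k2
  linarith [hz'.2, hz2'.2]

theorem GP_O {X Y M V : Type*} [TopologicalSpace X] [TopologicalSpace Y] [PseudoMetricSpace M]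
    [NormedAddCommGroup V]
    (f : X → Y) (hfc : IsClosedMap f) (h : X → M) (hh : Continuous h) (η : ℝ) :
    PropO f (GP (V := V) f h η) := by
  intro y u hu
  obtain ⟨δ, hδ, η', hη', W, hW, H⟩ := GP_strong f hfc h hh η y u hu
  refine ⟨δ / 4, by positivity, ?_⟩
  filter_upwards [hW] with y' hy' u' hu'
  refine ⟨δ / 4, by positivity, η', hη', fun x x' hx hx' hd => H x x' (hx ▸ hy') (hx' ▸ hy') ?_⟩
  have k1 := dist_triangle4 (u x) (u' x) (u' x') (u x')
  have k2 := hu' x hx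
  have k3 := hu' x' hx'
  rw [dist_comm] at k2
  linarith

theorem GQ_O {X Y : Type*} [TopologicalSpace X] [TopologicalSpace Y] {p : ℕ}
    (f : X → Y) (hfc : IsClosedMap f) (s : Finset (Fin p)) (r : Fin p → ℝ) :
    PropO f (GQ f s r) := by
  rintro y u ⟨δ, hδ, H⟩
  refine ⟨δ / 4, by positivity, ?_⟩
  filter_upwards [closed_near f hfc u u.continuous (δ / 4) (by positivity) y] with y' hy' u' hu'
  refine ⟨δ / 2, by positivity, fun x hx => ?_⟩
  obtain ⟨z, hz, hd⟩ := hy' x hx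
  obtain ⟨i, hi, hr⟩ := H z hz
  refine ⟨i, hi, ?_⟩
  have h1 := hu' x hx
  have k1 : |u' x i - u x i| ≤ dist (u' x) (u x) := by
    rw [dist_eq_norm]; exact PiLp.norm_apply_le (u' x - u x) i
  have k2 : |u x i - u z i| ≤ dist (u x) (u z) := by
    rw [dist_eq_norm]; exact PiLp.norm_apply_le (u x - u z) i
  have k3 := abs_sub_le (u z i) (u x i) (r i)
  have k4 := abs_sub_le (u x i) (u' x i) (r i)
  rw [abs_sub_comm] at k1 k2
  linarith

theorem GP_Z {X Y M : Type*} [TopologicalSpace X] [NormalSpace X] [TopologicalSpace Y] [T1Space Y]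
    [PseudoMetricSpace M] [CompactSpace M] {n m p : ℕ} (hp : 2 * n + m < p)
    (f : X → Y) (hf : Continuous f) (hs : Function.Surjective f)
    (hdim : ∀ y, CovDimLE (f ⁻¹' {y}) n) (h : X → M) (hh : Continuous h) (η : ℝ) (hη : 0 < η) :
    PropZ m f (GP (V := EuclideanSpace ℝ (Fin p)) f h η) := by
  classical
  intro y K hK hKs δ hδ
  obtain ⟨N, μ, pts, hμ, hμ1, hμc, hμu, hμh⟩ := nerve (f ⁻¹' {y}) (isClosed_singleton.preimage hf)
    (hs y) (hdim y) h hh K hK (δ / 4) (η / 2) (by positivity) (by positivity)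
  obtain ⟨S, hSc, hSl, hSK⟩ := hKs
  obtain ⟨w, -, hw, H⟩ := gp_fin (F := EuclideanSpace ℝ (Fin p)) m (2 * n)
    (by rw [finrank_euclideanSpace_fin]; exact hp) N
    ((fun s : (Σ d : ℕ, ((Fin d → ℝ) → BoundedContinuousFunction X (EuclideanSpace ℝ (Fin p)))) =>
      (⟨s.1, fun t i => s.2 t (pts i)⟩ : Σ d : ℕ, ((Fin d → ℝ) → Fin N → EuclideanSpace ℝ (Fin p)))) '' S)
    (hSc.image _) (by
      rintro _ ⟨s, hs, rfl⟩
      refine ⟨(hSl s hs).1, fun i => ?_⟩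
      exact (BoundedContinuousFunction.lipschitz_eval_const (pts i)).locallyLipschitz.comp
        (hSl s hs).2) (δ / 4) (by positivity)
  obtain ⟨R, hRl, hR⟩ := approx_op μ hμ pts w
  refine ⟨R, hRl, fun u hu => ⟨?_, fun x hx => ?_⟩⟩
  · have := hSK hu
    simp only [mem_iUnion] at this
    obtain ⟨s, hs, t, rfl⟩ := this
    obtain ⟨δ0, hδ0, H⟩ := H _ ⟨s, hs, rfl⟩ t
    refine ⟨δ0, hδ0, η / 2, by linarith, fun x x' hx hx' hd => ?_⟩
    by_contra hcon
    have hdisj : ∀ i, μ i x = 0 ∨ μ i x' = 0 := by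
      intro i
      by_contra h'
      push Not at h'
      exact hcon (hμh x hx x' hx' i h'.1 h'.2)
    have habs : ∀ i, |μ i x - μ i x'| = μ i x + μ i x' := by
      intro i
      rcases hdisj i with h0 | h0
      · rw [h0, zero_sub, abs_neg, abs_of_nonneg (hμ i x').1, zero_add]
      · rw [h0, sub_zero, abs_of_nonneg (hμ i x).1, add_zero]
    have k := H (fun i => μ i x - μ i x') (by
        rw [Finset.sum_sub_distrib, hμ1 x hx, hμ1 x' hx', sub_self])
      (by
        simp only [habs]
        rw [Finset.sum_add_distrib, hμ1 x hx, hμ1 x' hx']; norm_num)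
      (by
        refine (Finset.card_le_card (t := (Finset.univ.filter fun i => μ i x ≠ 0) ∪
          (Finset.univ.filter fun i => μ i x' ≠ 0)) ?_).trans
          ((Finset.card_union_le _ _).trans ?_)
        · intro i hi
          simp only [Finset.mem_filter, Finset.mem_univ, true_and, Finset.mem_union] at hi ⊢
          by_contra hcon
          push Not at hcon
          rw [hcon.1, hcon.2, sub_self] at hi
          exact hi rfl
        · have := hμc x hx
          have := hμc x' hx'
          omega)
    have e : ∑ i, (μ i x - μ i x') • (s.2 t (pts i) + w i) = R (s.2 t) x - R (s.2 t) x' := by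
      rw [hR, hR, ← Finset.sum_sub_distrib]
      exact Finset.sum_congr rfl fun i _ => sub_smul _ _ _
    simp only at k
    rw [e, ← dist_eq_norm] at k
    linarith
  · rw [hR]
    exact approx_close μ hμ pts w u x (hμ1 x hx) δ (fun i hi => hμu x hx i hi u hu) hw hδ

theorem GQ_Z {X Y : Type*} [TopologicalSpace X] [NormalSpace X] [TopologicalSpace Y] [T1Space Y]
    {n m p : ℕ} (f : X → Y) (hf : Continuous f) (hs : Function.Surjective f)
    (hdim : ∀ y, CovDimLE (f ⁻¹' {y}) n) (s : Finset (Fin p)) (r : Fin p → ℝ)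
    (hp : n + m < s.card) :
    PropZ m f (GQ f s r) := by
  classical
  intro y K hK hKs δ hδ
  obtain ⟨N, μ, pts, hμ, hμ1, hμc, hμu, -⟩ := nerve (M := Unit) (f ⁻¹' {y})
    (isClosed_singleton.preimage hf)
    (hs y) (hdim y) (fun _ => ()) continuous_const K hK (δ / 4) 1 (by positivity) (by positivity)
  obtain ⟨S, hSc, hSl, hSK⟩ := hKs
  let π : EuclideanSpace ℝ (Fin p) → (s → ℝ) := fun v i => v i
  have hπ : LocallyLipschitz π := by
    have : ContDiff ℝ 1 π := by
      rw [contDiff_pi]; intro i; fun_prop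
    exact this.locallyLipschitz
  let ι : (s → ℝ) → EuclideanSpace ℝ (Fin p) := fun w =>
    WithLp.toLp 2 (fun j => if h : j ∈ s then w ⟨j, h⟩ else 0)
  have hι : Continuous ι := by
    refine (PiLp.continuous_toLp 2 _).comp (continuous_pi fun j => ?_)
    by_cases h : j ∈ s
    · simp only [h, dite_true]; fun_prop
    · simp only [h, dite_false]; fun_prop
  have hι0 : ι 0 = 0 := by ext j; simp [ι]
  have hπι : ∀ w, π (ι w) = w := by intro w; ext j; simp [π, ι]
  obtain ⟨ε, hε, hει⟩ : ∃ ε > 0, ∀ w, ‖w‖ < ε → ‖ι w‖ < δ / 4 := by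
    obtain ⟨ε, hε, h⟩ := Metric.continuous_iff.1 hι 0 (δ / 4) (by positivity)
    refine ⟨ε, hε, fun w hw => ?_⟩
    have := h w (by simpa using hw)
    rwa [hι0, dist_zero_right] at this
  obtain ⟨w, hw0, hw, H⟩ := gp_fin (F := s → ℝ) m n
    (by rw [Module.finrank_fintype_fun_eq_card, Fintype.card_coe]; exact hp) (N + 1)
    ((fun s' : (Σ d : ℕ, ((Fin d → ℝ) → BoundedContinuousFunction X (EuclideanSpace ℝ (Fin p)))) =>
      (⟨s'.1, fun t => Fin.cons (fun i => r i) (fun i => π (s'.2 t (pts i)))⟩ :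
        Σ d : ℕ, ((Fin d → ℝ) → Fin (N+1) → (s → ℝ)))) '' S)
    (hSc.image _) (by
      rintro _ ⟨s', hs, rfl⟩
      refine ⟨(hSl s' hs).1, fun i => ?_⟩
      refine Fin.cases ?_ (fun i => ?_) i
      · simp only [Fin.cons_zero]; exact LocallyLipschitz.const _
      · simp only [Fin.cons_succ]
        exact hπ.comp ((BoundedContinuousFunction.lipschitz_eval_const (pts i)).locallyLipschitz.comp
          (hSl s' hs).2)) ε hε
  obtain ⟨R, hRl, hR⟩ := approx_op μ hμ pts (fun i => ι (w i.succ))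
  refine ⟨R, hRl, fun u hu => ⟨?_, fun x hx => ?_⟩⟩
  · have := hSK hu
    simp only [mem_iUnion] at this
    obtain ⟨s', hs, t, rfl⟩ := this
    obtain ⟨δ0, hδ0, H⟩ := H _ ⟨s', hs, rfl⟩ t
    refine ⟨δ0, hδ0, fun x hx => ?_⟩
    have k := H (Fin.cons (-1) (fun i => μ i x)) (by
        simp [Fin.sum_univ_succ, hμ1 x hx])
      (by
        have : ∀ i, |μ i x| = μ i x := fun i => abs_of_nonneg (hμ i x).1
        simp only [Fin.sum_univ_succ, Fin.cons_zero, Fin.cons_succ, this, hμ1 x hx]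
        norm_num)
      (by
        have h1 := hμc x hx
        have h2 : (Finset.univ.filter fun i : Fin (N+1) =>
            (Fin.cons (-1) (fun i => μ i x) : Fin (N+1) → ℝ) i ≠ 0) ⊆
            insert 0 ((Finset.univ.filter fun i => μ i x ≠ 0).map (Fin.succEmb N)) := by
          intro i
          refine Fin.cases ?_ (fun i => ?_) i
          · simp
          · simp
        have h3 := Finset.card_le_card h2
        have h4 := Finset.card_insert_le (0 : Fin (N+1))
          ((Finset.univ.filter fun i => μ i x ≠ 0).map (Fin.succEmb N))
        rw [Finset.card_map] at h4
        omega)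
    have e : ∑ i, (Fin.cons (-1) (fun i => μ i x) : Fin (N+1) → ℝ) i •
        ((Fin.cons (fun i => r i) (fun i => π (s'.2 t (pts i))) : Fin (N+1) → (s → ℝ)) i + w i)
        = fun j : s => R (s'.2 t) x j - r j := by
      rw [hR, Fin.sum_univ_succ]
      simp only [Fin.cons_zero, Fin.cons_succ]
      rw [hw0 0 rfl]
      ext j
      simp only [Pi.add_apply, Pi.smul_apply, Finset.sum_apply, smul_eq_mul, Pi.zero_apply,
        WithLp.ofLp_sum, PiLp.smul_apply, PiLp.add_apply]
      have : ∀ i, (ι (w i)) j = w i j := fun i => congrFun (hπι (w i)) j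
      simp only [this, π]
      ring
    simp only at k
    rw [e] at k
    by_contra hcon
    push Not at hcon
    have : ‖(fun j : s => R (s'.2 t) x j - r j)‖ < δ0 := by
      rw [pi_norm_lt_iff hδ0]
      exact fun j => hcon j j.2
    linarith
  · rw [hR]
    exact approx_close μ hμ pts _ u x (hμ1 x hx) δ (fun i hi => hμu x hx i hi u hu)
      (fun i => hει _ (hw _)) hδ

theorem zd_refine {α ι : Type*} [TopologicalSpace α] [SecondCountableTopology α]
    (hb : ∀ x : α, ∀ O : Set α, IsOpen O → x ∈ O → ∃ C, IsClopen C ∧ x ∈ C ∧ C ⊆ O)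
    (U : ι → Set α) (hU : ∀ i, IsOpen (U i)) (hc : (⋃ i, U i) = univ) :
    ∃ E : ι → Set α, (∀ i, IsClosed (E i)) ∧ (∀ i j, i ≠ j → Disjoint (E i) (E j)) ∧
      (∀ i, E i ⊆ U i) ∧ (⋃ i, E i) = univ := by
  classical
  rcases isEmpty_or_nonempty α with hα | hα
  · exact ⟨fun _ => ∅, fun _ => isClosed_empty, fun _ _ _ => disjoint_bot_left,
      fun _ => empty_subset _, by ext x; exact (hα.false x).elim⟩
  have h1 : ∀ x : α, ∃ i, x ∈ U i := fun x => by
    have : x ∈ ⋃ i, U i := hc ▸ mem_univ x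
    simpa using this
  choose c hcx using h1
  have h2 : ∀ x, ∃ C, IsClopen C ∧ x ∈ C ∧ C ⊆ U (c x) := fun x => hb x _ (hU _) (hcx x)
  choose C hC hxC hCU using h2
  obtain ⟨t, ht, htc⟩ := TopologicalSpace.countable_cover_nhds
    (fun x => (hC x).isOpen.mem_nhds (hxC x))
  have htne : t.Nonempty := by
    by_contra h
    rw [not_nonempty_iff_eq_empty] at h
    subst h
    simp only [mem_empty_iff_false, iUnion_of_empty, iUnion_empty] at htc
    exact (empty_ne_univ htc)
  obtain ⟨e, rfl⟩ := ht.exists_eq_range htne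
  let B : ℕ → Set α := fun l => C (e l) \ ⋃ k ∈ Finset.range l, C (e k)
  have hBo : ∀ l, IsOpen (B l) := by
    intro l
    refine (hC _).isOpen.sdiff ?_
    exact (Finset.range l).finite_toSet.isClosed_biUnion fun k _ => (hC _).isClosed
  have hBd : ∀ k l, k < l → Disjoint (B k) (B l) := by
    intro k l hkl
    rw [Set.disjoint_left]
    rintro x ⟨hx, _⟩ ⟨_, h⟩
    apply h
    simp only [Finset.mem_range, mem_iUnion]
    exact ⟨k, hkl, hx⟩
  have hBc : ∀ x, ∃ l, x ∈ B l := by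
    intro x
    have hx : ∃ l, x ∈ C (e l) := by
      have : x ∈ ⋃ x ∈ range e, C x := htc ▸ mem_univ x
      simpa using this
    refine ⟨Nat.find hx, Nat.find_spec hx, ?_⟩
    simp only [Finset.mem_range, mem_iUnion, not_exists]
    exact fun k hk => Nat.find_min hx hk
  let E : ι → Set α := fun i => ⋃ l ∈ {l | c (e l) = i}, B l
  have hEo : ∀ i, IsOpen (E i) := fun i => isOpen_biUnion fun l _ => hBo l
  have hEd : ∀ i j, i ≠ j → Disjoint (E i) (E j) := by
    intro i j hij
    rw [Set.disjoint_left]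
    intro x hx hx'
    simp only [E, mem_iUnion, mem_ofPred_eq] at hx hx'
    obtain ⟨k, hk, hkx⟩ := hx
    obtain ⟨l, hl, hlx⟩ := hx'
    rcases lt_trichotomy k l with h | h | h
    · exact Set.disjoint_left.1 (hBd k l h) hkx hlx
    · subst h; exact hij (hk.symm.trans hl)
    · exact Set.disjoint_left.1 (hBd l k h) hlx hkx
  have hEc : ∀ x, ∃ i, x ∈ E i := by
    intro x
    obtain ⟨l, hl⟩ := hBc x
    refine ⟨c (e l), ?_⟩
    simp only [E, mem_iUnion, mem_ofPred_eq]
    exact ⟨l, rfl, hl⟩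
  refine ⟨E, fun i => ?_, hEd, fun i x hx => ?_, by ext x; simpa using hEc x⟩
  · have : E i = (⋃ j ∈ {j | j ≠ i}, E j)ᶜ := by
      ext x
      simp only [mem_compl_iff, mem_iUnion, mem_ofPred_eq, not_exists]
      constructor
      · intro hx j hj hxj
        exact Set.disjoint_left.1 (hEd j i hj) hxj hx
      · intro h
        obtain ⟨j, hj⟩ := hEc x
        by_cases hji : j = i
        · exact hji ▸ hj
        · exact (h j hji hj).elim
    rw [this]
    exact (isOpen_biUnion fun j _ => hEo j).isClosed_compl
  · simp only [E, mem_iUnion, mem_ofPred_eq] at hx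
    obtain ⟨k, rfl, hk⟩ := hx
    exact hCU _ hk.1

theorem thicken {α ι : Type*} [TopologicalSpace α] [NormalSpace α] [Finite ι]
    (C U : ι → Set α) (hC : ∀ i, IsClosed (C i)) (hd : ∀ i j, i ≠ j → Disjoint (C i) (C j))
    (hU : ∀ i, IsOpen (U i)) (hCU : ∀ i, C i ⊆ U i) :
    ∃ D : ι → Set α, (∀ i, IsClosed (D i)) ∧ (∀ i j, i ≠ j → Disjoint (D i) (D j)) ∧
      (∀ i, D i ⊆ U i) ∧ ∀ i, C i ⊆ interior (D i) := by
  have hdis : Pairwise (fun i j => Disjoint (𝓝ˢ (C i)) (𝓝ˢ (C j))) := by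
    intro i j hij
    exact disjoint_nhdsSet_nhdsSet (hC i) (hC j) (hd i j hij)
  obtain ⟨s, hs, hsd⟩ := hdis.exists_mem_filter_of_disjoint
  have h : ∀ i, ∃ G, IsOpen G ∧ C i ⊆ G ∧ closure G ⊆ interior (s i) ∩ U i := by
    intro i
    exact normal_exists_closure_subset (hC i) (isOpen_interior.inter (hU i))
      (subset_inter (subset_interior_iff_mem_nhdsSet.2 (hs i)) (hCU i))
  choose G hG hCG hGs using h
  refine ⟨fun i => closure (G i), fun i => isClosed_closure, fun i j hij => ?_,
    fun i => (hGs i).trans inter_subset_right, fun i => ?_⟩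
  · exact (hsd hij).mono ((hGs i).trans (inter_subset_left.trans interior_subset))
      ((hGs j).trans (inter_subset_left.trans interior_subset))
  · exact (hCG i).trans (interior_maximal subset_closure (hG i))

theorem zd_sum {α ι : Type*} [TopologicalSpace α] [NormalSpace α] [Finite ι]
    (P : ℕ → Set α) (hP : ∀ l, IsClosed (P l)) (hPc : ∀ x, ∃ l, x ∈ P l)
    (hz : ∀ l, ∀ U : ι → Set (P l), (∀ i, IsOpen (U i)) → (⋃ i, U i) = univ →
      ∃ E : ι → Set (P l), (∀ i, IsClosed (E i)) ∧ (∀ i j, i ≠ j → Disjoint (E i) (E j)) ∧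
      (∀ i, E i ⊆ U i) ∧ (⋃ i, E i) = univ)
    (U : ι → Set α) (hU : ∀ i, IsOpen (U i)) (hc : (⋃ i, U i) = univ) :
    ∃ V : ι → Set α, (∀ i, IsOpen (V i)) ∧ (∀ i j, i ≠ j → Disjoint (V i) (V j)) ∧
      (∀ i, V i ⊆ U i) ∧ ∀ x, ∃ i, x ∈ V i := by
  classical
  let Q : Type _ := {D : ι → Set α // (∀ i, IsClosed (D i)) ∧
    (∀ i j, i ≠ j → Disjoint (D i) (D j)) ∧ (∀ i, D i ⊆ U i)}
  have step : ∀ (l : ℕ) (D : Q), ∃ D' : Q, (∀ i, D.1 i ⊆ interior (D'.1 i)) ∧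
      ∀ x ∈ P l, ∃ i, x ∈ interior (D'.1 i) := by
    rintro l ⟨D, hDc, hDd, hDU⟩
    have hOo : ∀ i, IsOpen (U i \ ⋃ k ∈ {k | k ≠ i}, D k) := fun i =>
      (hU i).sdiff ((toFinite _).isClosed_biUnion fun k _ => hDc k)
    obtain ⟨E, hE, hEd, hEU, hEc⟩ := hz l
      (fun i => Subtype.val ⁻¹' (U i \ ⋃ k ∈ {k | k ≠ i}, D k))
      (fun i => (hOo i).preimage continuous_subtype_val) (by
        ext x
        simp only [mem_iUnion, mem_univ, iff_true, mem_preimage, mem_sdiff, mem_ofPred_eq, not_exists]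
        by_cases h : ∃ k, x.1 ∈ D k
        · obtain ⟨k, hk⟩ := h
          exact ⟨k, hDU k hk, fun j hj hx => Set.disjoint_left.1 (hDd j k hj) hx hk⟩
        · push Not at h
          have : x.1 ∈ ⋃ i, U i := hc ▸ mem_univ _
          simp only [mem_iUnion] at this
          obtain ⟨i, hi⟩ := this
          exact ⟨i, hi, fun j _ => h j⟩)
    have hED : ∀ i j, i ≠ j → Disjoint (Subtype.val '' E i) (D j) := by
      intro i j hij
      rw [Set.disjoint_left]
      rintro _ ⟨x, hx, rfl⟩ hj
      apply (hEU i hx).2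
      simp only [mem_iUnion, mem_ofPred_eq]
      exact ⟨j, hij.symm, hj⟩
    obtain ⟨D', h1, h2, h3, h4⟩ := thicken (fun i => D i ∪ Subtype.val '' E i) U
      (fun i => (hDc i).union ((hP l).isClosedMap_subtype_val _ (hE i)))
      (fun i j hij => by
        rw [Set.disjoint_union_left, Set.disjoint_union_right, Set.disjoint_union_right]
        refine ⟨⟨hDd i j hij, (hED j i hij.symm).symm⟩, hED i j hij, ?_⟩
        exact (disjoint_image_iff Subtype.val_injective).2 (hEd i j hij))
      hU (fun i => union_subset (hDU i) (by rintro _ ⟨x, hx, rfl⟩; exact (hEU i hx).1))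
    refine ⟨⟨D', h1, h2, h3⟩, fun i => subset_union_left.trans (h4 i), fun x hx => ?_⟩
    have : (⟨x, hx⟩ : P l) ∈ ⋃ i, E i := hEc ▸ mem_univ _
    simp only [mem_iUnion] at this
    obtain ⟨i, hi⟩ := this
    exact ⟨i, h4 i (Or.inr ⟨_, hi, rfl⟩)⟩
  choose F hF1 hF2 using step
  let D : ℕ → Q := fun l => Nat.rec (⟨fun _ => ∅, fun _ => isClosed_empty,
    fun _ _ _ => disjoint_bot_left, fun _ => empty_subset _⟩ : Q) (fun l d => F l d) l
  have hmono : ∀ i, Monotone fun l => (D l).1 i := fun i =>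
    monotone_nat_of_le_succ fun l => (hF1 l (D l) i).trans interior_subset
  refine ⟨fun i => ⋃ l, interior ((D l).1 i), fun i => isOpen_iUnion fun _ => isOpen_interior,
    fun i j hij => ?_, fun i => iUnion_subset fun l => interior_subset.trans ((D l).2.2.2 i),
    fun x => ?_⟩
  · rw [Set.disjoint_left]
    intro x hx hx'
    simp only [mem_iUnion] at hx hx'
    obtain ⟨k, hk⟩ := hx
    obtain ⟨l, hl⟩ := hx'
    exact Set.disjoint_left.1 ((D (max k l)).2.2.1 i j hij)
      (hmono i (le_max_left k l) (interior_subset hk))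
      (hmono j (le_max_right k l) (interior_subset hl))
  · obtain ⟨l, hl⟩ := hPc x
    obtain ⟨i, hi⟩ := hF2 l (D l) x hl
    exact ⟨i, mem_iUnion.2 ⟨l + 1, hi⟩⟩

theorem extend_disj {M ι : Type*} [MetricSpace M] [Finite ι] (Z : Set M)
    (V : ι → Set Z) (hV : ∀ i, IsOpen (V i)) (hd : ∀ i j, i ≠ j → Disjoint (V i) (V j))
    (U : ι → Set M) (hU : ∀ i, IsOpen (U i)) (hVU : ∀ i, ∀ x ∈ V i, x.1 ∈ U i) :
    ∃ W : ι → Set M, (∀ i, IsOpen (W i)) ∧ (∀ i j, i ≠ j → Disjoint (W i) (W j)) ∧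
      (∀ i, W i ⊆ U i) ∧ ∀ i, ∀ x ∈ V i, x.1 ∈ W i := by
  let W : ι → Set M := fun i => U i ∩ ⋂ k ∈ {k | k ≠ i},
    {x | Metric.infEDist x (Subtype.val '' V i) < Metric.infEDist x (Subtype.val '' V k)}
  refine ⟨W, fun i => (hU i).inter ((toFinite _).isOpen_biInter fun k _ =>
    isOpen_lt Metric.continuous_infEDist Metric.continuous_infEDist), fun i j hij => ?_,
    fun i => inter_subset_left, fun i x hx => ⟨hVU i x hx, ?_⟩⟩
  · rw [Set.disjoint_left]
    rintro x ⟨_, h1⟩ ⟨_, h2⟩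
    simp only [mem_iInter, mem_ofPred_eq] at h1 h2
    exact lt_asymm (h1 j hij.symm) (h2 i hij)
  · simp only [mem_iInter, mem_ofPred_eq]
    intro k hk
    rw [Metric.infEDist_zero_of_mem (mem_image_of_mem _ hx)]
    rw [pos_iff_ne_zero, ne_eq, ← Metric.mem_closure_iff_infEDist_zero, ← closure_subtype]
    intro h
    obtain ⟨z, hz, hz'⟩ := mem_closure_iff.1 h _ (hV i) hx
    exact Set.disjoint_left.1 (hd k i hk) hz' hz

/-- The number of rational coordinates. -/
def ratSet {p : ℕ} (x : EuclideanSpace ℝ (Fin p)) : Set (Fin p) := {i | ∃ q : ℚ, x i = q}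

theorem exact_piece {p : ℕ} {S : Type*} [TopologicalSpace S]
    (φ : S → EuclideanSpace ℝ (Fin p)) (hφ : IsInducing φ) (T : Set (Fin p)) (q : Fin p → ℚ)
    (hS : ∀ x, ratSet (φ x) = T ∧ ∀ i ∈ T, φ x i = q i) :
    ∀ x : S, ∀ O : Set S, IsOpen O → x ∈ O → ∃ C, IsClopen C ∧ x ∈ C ∧ C ⊆ O := by
  classical
  intro x O hO hx
  obtain ⟨O', hO', rfl⟩ := hφ.isOpen_iff.1 hO
  have hx' : (φ x) ∈ O' := hx
  have hO2 : IsOpen ((WithLp.toLp 2 : (Fin p → ℝ) → EuclideanSpace ℝ (Fin p)) ⁻¹' O') :=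
    hO'.preimage (PiLp.continuous_toLp 2 _)
  obtain ⟨ε, hε, hb⟩ := Metric.isOpen_iff.1 hO2 (WithLp.ofLp (φ x)) hx'
  have h : ∀ i, ∃ a b : ℚ, φ x i - ε < a ∧ (a : ℝ) < φ x i ∧ φ x i < b ∧ (b : ℝ) < φ x i + ε := by
    intro i
    obtain ⟨a, ha, ha'⟩ := exists_rat_btwn (sub_lt_self (φ x i) hε)
    obtain ⟨b, hb, hb'⟩ := exists_rat_btwn (lt_add_of_pos_right (φ x i) hε)
    exact ⟨a, b, ha, ha', hb, hb'⟩
  choose a b h1 h2 h3 h4 using h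
  have hcont : ∀ i, Continuous fun y : S => φ y i := fun i => (EuclideanSpace.proj (𝕜 := ℝ) i).continuous.comp hφ.continuous
  have key : {y : S | ∀ i ∈ Tᶜ, φ y i ∈ Ioo (a i : ℝ) (b i)} =
      {y : S | ∀ i ∈ Tᶜ, φ y i ∈ Icc (a i : ℝ) (b i)} := by
    ext y
    refine ⟨fun h i hi => Ioo_subset_Icc_self (h i hi), fun h i hi => ?_⟩
    have hn : ¬ ∃ q : ℚ, φ y i = q := by
      intro hq
      exact hi ((hS y).1 ▸ hq)
    push Not at hn
    exact ⟨lt_of_le_of_ne (h i hi).1 (hn _).symm, lt_of_le_of_ne (h i hi).2 (hn _)⟩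
  refine ⟨{y : S | ∀ i ∈ Tᶜ, φ y i ∈ Ioo (a i : ℝ) (b i)}, ⟨?_, ?_⟩, fun i _ => ⟨h2 i, h3 i⟩, ?_⟩
  · rw [key]
    have : {y : S | ∀ i ∈ Tᶜ, φ y i ∈ Icc (a i : ℝ) (b i)} =
        ⋂ i ∈ Tᶜ, (fun y : S => φ y i) ⁻¹' Icc (a i : ℝ) (b i) := by ext; simp
    rw [this]
    exact isClosed_biInter fun i _ => isClosed_Icc.preimage (hcont i)
  · have : {y : S | ∀ i ∈ Tᶜ, φ y i ∈ Ioo (a i : ℝ) (b i)} =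
        ⋂ i ∈ Tᶜ, (fun y : S => φ y i) ⁻¹' Ioo (a i : ℝ) (b i) := by ext; simp
    rw [this]
    exact (toFinite _).isOpen_biInter fun i _ => isOpen_Ioo.preimage (hcont i)
  · intro y hy
    have : WithLp.ofLp (φ y) ∈ Metric.ball (WithLp.ofLp (φ x)) ε := by
      rw [Metric.mem_ball, dist_pi_lt_iff hε]
      intro i
      by_cases hi : i ∈ T
      · rw [(hS y).2 i hi, (hS x).2 i hi, dist_self]; exact hε
      · have := hy i hi
        rw [Real.dist_eq, abs_lt]
        have := h1 i; have := h4 i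
        constructor <;> linarith [(hy i hi).1, (hy i hi).2]
    exact hb this

theorem exact_layer {p : ℕ} {S : Type*} [TopologicalSpace S] [NormalSpace S]
    [SecondCountableTopology S] (φ : S → EuclideanSpace ℝ (Fin p)) (hφ : IsInducing φ) (j : ℕ)
    (hS : ∀ x, (ratSet (φ x)).ncard = j) {ι : Type*} [Finite ι]
    (U : ι → Set S) (hU : ∀ i, IsOpen (U i)) (hc : (⋃ i, U i) = univ) :
    ∃ V : ι → Set S, (∀ i, IsOpen (V i)) ∧ (∀ i j, i ≠ j → Disjoint (V i) (V j)) ∧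
      (∀ i, V i ⊆ U i) ∧ ∀ x, ∃ i, x ∈ V i := by
  classical
  obtain ⟨e, he⟩ := exists_surjective_nat (Finset (Fin p) × (Fin p → ℚ))
  have hcont : ∀ i, Continuous fun y : S => φ y i := fun i =>
    (EuclideanSpace.proj (𝕜 := ℝ) i).continuous.comp hφ.continuous
  refine zd_sum (fun l => {x : S | (e l).1.card = j ∧ ∀ i ∈ (e l).1, φ x i = (e l).2 i})
    (fun l => ?_) (fun x => ?_) (fun l W hW hWc => ?_) U hU hc
  · have : {x : S | (e l).1.card = j ∧ ∀ i ∈ (e l).1, φ x i = (e l).2 i} =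
      {x : S | (e l).1.card = j} ∩ ⋂ i ∈ (e l).1, {x : S | φ x i = (e l).2 i} := by
      ext; simp
    rw [this]
    exact isClosed_const.inter (isClosed_biInter fun i _ => isClosed_eq (hcont i) continuous_const)
  · have : ∀ i, ∃ q : ℚ, i ∈ ratSet (φ x) → φ x i = q := by
      intro i
      by_cases h : i ∈ ratSet (φ x)
      · obtain ⟨q, hq⟩ := h
        exact ⟨q, fun _ => hq⟩
      · exact ⟨0, fun h' => (h h').elim⟩
    choose q hq using this
    obtain ⟨l, hl⟩ := he ((ratSet (φ x)).toFinset, q)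
    refine ⟨l, ?_, ?_⟩
    · rw [hl, ← hS x, Set.ncard_eq_toFinset_card']
    · intro i hi
      rw [hl] at hi ⊢
      exact hq i (by simpa using hi)
  · refine zd_refine ?_ W hW hWc
    refine exact_piece (fun x => φ x.1) (hφ.comp IsInducing.subtypeVal) ((e l).1 : Set (Fin p))
      (e l).2 ?_
    rintro ⟨x, hx1, hx2⟩
    refine ⟨?_, fun i hi => hx2 i hi⟩
    symm
    apply Set.eq_of_subset_of_ncard_le
    · intro i hi
      exact ⟨_, hx2 i hi⟩
    · rw [hS x, Set.ncard_coe_finset, hx1]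
    · exact toFinite _

/-- Nobeling's lemma. -/
theorem noebeling {p : ℕ} (S : Set (EuclideanSpace ℝ (Fin p))) (a d : ℕ)
    (hS : ∀ x ∈ S, a ≤ (ratSet x).ncard ∧ (ratSet x).ncard ≤ a + d) : CovDimLE S d := by
  classical
  intro ι U hι hU hc
  have h : ∀ j : Fin (d + 1), ∃ W : ι → Set S, (∀ i, IsOpen (W i)) ∧
      (∀ i k, i ≠ k → Disjoint (W i) (W k)) ∧ (∀ i, W i ⊆ U i) ∧
      ∀ x : S, (ratSet x.1).ncard = a + j → ∃ i, x ∈ W i := by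
    intro j
    let Z : Set S := {x | (ratSet x.1).ncard = a + j}
    obtain ⟨V, hV, hVd, hVU, hVc⟩ := exact_layer (S := Z) (fun x => x.1.1)
      (IsInducing.subtypeVal.comp IsInducing.subtypeVal) (a + j) (fun x => x.2)
      (fun i => Subtype.val ⁻¹' U i) (fun i => (hU i).preimage continuous_subtype_val)
      (by rw [← preimage_iUnion, hc, preimage_univ])
    obtain ⟨W, hW, hWd, hWU, hVW⟩ := extend_disj Z V hV hVd U hU (fun i x hx => hVU i hx)
    refine ⟨W, hW, hWd, hWU, fun x hx => ?_⟩
    obtain ⟨i, hi⟩ := hVc ⟨x, hx⟩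
    exact ⟨i, hVW i _ hi⟩
  choose W hW hWd hWU hWc using h
  refine ⟨fun i => ⋃ j, W j i, fun i => isOpen_iUnion fun j => hW j i,
    fun i => iUnion_subset fun j => hWU j i, ?_, fun x => ?_⟩
  · ext x
    simp only [mem_iUnion, mem_univ, iff_true]
    obtain ⟨h1, h2⟩ := hS x.1 x.2
    obtain ⟨i, hi⟩ := hWc ⟨(ratSet x.1).ncard - a, by omega⟩ x (by simp only; omega)
    exact ⟨i, _, hi⟩
  · have h1 : ∀ i : {i | x ∈ ⋃ j, W j i}, ∃ j, x ∈ W j i := fun i => mem_iUnion.1 i.2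
    choose c hcx using h1
    have hinj : Function.Injective c := by
      intro i k hik
      by_contra hne
      have hne' : i.1 ≠ k.1 := fun h => hne (Subtype.ext h)
      exact Set.disjoint_left.1 (hWd (c i) i k hne') (hcx i) (hik ▸ hcx k)
    have := Nat.card_le_card_of_injective c hinj
    rw [Nat.card_fin, Nat.card_coe_set_eq] at this
    exact_mod_cast this

theorem hilbertCube_compact : CompactSpace ↥HilbertCube := by
  classical
  rw [← isCompact_iff_compactSpace]
  let Φ : (∀ i : ℕ, Icc (0:ℝ) (1 / 2 ^ i)) → lp (fun _ : ℕ => ℝ) 2 :=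
    fun z => ∑' i, lp.single 2 i (z i : ℝ)
  have hΦ : Continuous Φ := by
    refine continuous_tsum (u := fun i => (1 / 2 : ℝ) ^ i) (fun i => ?_)
      (summable_geometric_two) (fun i z => ?_)
    · exact (lp.isometry_single (E := fun _ : ℕ => ℝ) (p := 2) i).continuous.comp
        (continuous_subtype_val.comp (continuous_apply i))
    · rw [lp.norm_single (by norm_num), Real.norm_eq_abs, abs_of_nonneg (z i).2.1, one_div_pow]
      exact (z i).2.2
  have hsub : HilbertCube ⊆ range Φ := by
    intro x hx
    exact ⟨fun i => ⟨x i, hx i⟩, (lp.hasSum_single (by norm_num) x).tsum_eq⟩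
  have hclosed : IsClosed HilbertCube := by
    have : HilbertCube = ⋂ i : ℕ, (fun x : lp (fun _ : ℕ => ℝ) 2 => (x : ℕ → ℝ) i) ⁻¹'
        Icc (0:ℝ) (1 / 2 ^ i) := by
      ext x; simp [HilbertCube]
    rw [this]
    refine isClosed_iInter fun i => isClosed_Icc.preimage ?_
    have : LipschitzWith 1 (fun x : lp (fun _ : ℕ => ℝ) 2 => (x : ℕ → ℝ) i) := by
      refine LipschitzWith.of_dist_le_mul fun x x' => ?_
      rw [dist_eq_norm, dist_eq_norm, NNReal.coe_one, one_mul]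
      exact lp.norm_apply_le_norm (by norm_num) (x - x') i
    exact this.continuous
  exact (isCompact_range hΦ).of_isClosed_subset hclosed hsub

theorem embed_of_GP {X Y M V : Type*} [TopologicalSpace X] [T0Space X] [TopologicalSpace Y]
    [PseudoMetricSpace M] [NormedAddCommGroup V]
    (f : X → Y) (hf : Continuous f) (hfc : IsClosedMap f) (h : X → M) (hh : Continuous h)
    (hind : IsInducing (fun x => (f x, h x)))
    (u : BoundedContinuousFunction X V) (hu : ∀ q : ℕ, ∀ y, u ∈ GP f h (1 / ((q : ℝ) + 1)) y) :
    IsEmbedding (fun x => (f x, u x)) := by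
  refine IsInducing.isEmbedding ⟨?_⟩
  rw [← isInducing_iff, isInducing_iff_nhds]
  intro x
  apply le_antisymm
  · exact (Continuous.tendsto (by fun_prop : Continuous fun x => (f x, u x)) x).le_comap
  · rw [hind.nhds_eq_comap x]
    rw [nhds_prod_eq (x := f x) (y := h x), ((Filter.basis_sets (𝓝 (f x))).prod
      (Metric.nhds_basis_ball (x := h x))).comap _ |>.ge_iff]
    rintro ⟨N, η⟩ ⟨hN, hη⟩
    simp only [id] at hN hη
    obtain ⟨q, hq⟩ := exists_nat_one_div_lt hη
    obtain ⟨δ, hδ, η', hη', W, hW, H⟩ := GP_strong f hfc h hh _ (f x) u (hu q (f x))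
    refine ⟨(N ∩ W) ×ˢ Metric.ball (u x) δ, prod_mem_nhds (Filter.inter_mem hN hW)
      (Metric.ball_mem_nhds _ hδ), ?_⟩
    rintro x' ⟨⟨h1, h2⟩, h3⟩
    refine ⟨h1, ?_⟩
    have := H x' x h2 (mem_of_mem_nhds hW) h3
    simp only [Metric.mem_ball]
    linarith

theorem condR_of_GQ {X Y : Type*} [TopologicalSpace X] [TopologicalSpace Y] (n m : ℕ)
    (f : X → Y) (u : BoundedContinuousFunction X (EuclideanSpace ℝ (Fin (2*n+1+m))))
    (hu : ∀ (s : Finset (Fin (2*n+1+m))) (r : Fin (2*n+1+m) → ℚ), n + m < s.card → ∀ y,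
      u ∈ GQ f s (fun i => (r i : ℝ)) y)
    (g : X → ↥(cube (2*n+1+m))) (hg : ∀ x, (g x : EuclideanSpace ℝ (Fin (2*n+1+m))) = u x) :
    ConditionR f n m g := by
  classical
  intro y k hk P hP
  obtain ⟨s, r, hs, rfl⟩ := hP
  have key : ∀ v ∈ ((fun x => ((g x : EuclideanSpace ℝ (Fin (2*n+1+m))))) '' (f ⁻¹' {y})) ∩
      {x | ∀ i ∈ s, x i = (r i : ℝ)}, 2*n+1+m - k ≤ (ratSet v).ncard ∧ (ratSet v).ncard ≤ n + m := by
    rintro v ⟨⟨x, hx, rfl⟩, hv⟩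
    constructor
    · rw [← hs, ← Set.ncard_coe_finset]
      exact Set.ncard_le_ncard (fun i hi => ⟨r i, hv i hi⟩) (toFinite _)
    · by_contra hcon
      push Not at hcon
      simp only [hg] at hcon
      have : ∀ i, ∃ q : ℚ, i ∈ ratSet (u x) → u x i = q := by
        intro i
        by_cases h : i ∈ ratSet (u x)
        · obtain ⟨q, hq⟩ := h
          exact ⟨q, fun _ => hq⟩
        · exact ⟨0, fun h' => (h h').elim⟩
      choose q hq using this
      rw [Set.ncard_eq_toFinset_card'] at hcon
      obtain ⟨δ, hδ, H⟩ := hu _ q hcon y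
      obtain ⟨i, hi, hi'⟩ := H x hx
      rw [hq i (by simpa using hi), sub_self, abs_zero] at hi'
      linarith
  by_cases hkn : k ≤ n
  · intro ι U _ hU hc
    refine ⟨U, hU, fun _ => Subset.rfl, hc, fun x => ?_⟩
    have := key x.1 x.2
    omega
  · have e : ((k : ℤ) - n - 1) = ((k - n - 1 : ℕ) : ℤ) := by omega
    rw [e]
    refine noebeling _ (2*n+1+m-k) (k-n-1) fun v hv => ?_
    have := key v hv
    omega

/-- Proposition 4.4. Let `f : X → Y` be a closed surjection of countable
functional weight with `dim f ≤ n`, `X` normal Hausdorff, `Y` paracompact Hausdorff with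
`dim Y ≤ m`. Then the maps `g ∈ C(X, I^{2n+1+m})` with `f × g` an embedding and satisfying
condition (R) are dense in `C(X, I^{2n+1+m})` with the uniform convergence topology (realized via
bounded continuous maps with the sup metric; every continuous map into `I^{2n+1+m}` is
bounded). -/
theorem stmt17 {X Y : Type*} [TopologicalSpace X] [T2Space X] [NormalSpace X]
    [TopologicalSpace Y] [T2Space Y] [ParacompactSpace Y]
    (n m : ℕ) (f : X → Y) (hcont : Continuous f) (hclosed : IsClosedMap f)
    (hsurj : Function.Surjective f) (hw : HasCountableFunctionalWeight f)
    (hdimf : ∀ y : Y, CovDimLE ↥(f ⁻¹' {y}) n)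
    (hdimY : CovDimLE Y m) :
    Dense {g : BoundedContinuousFunction X ↥(cube (2*n+1+m)) |
        IsEmbedding (fun x => (f x, g x) : X → Y × ↥(cube (2*n+1+m))) ∧
        ConditionR f n m (fun x => g x)} := by
  classical
  obtain ⟨h, hh⟩ := hw
  have := hilbertCube_compact
  let J := ℕ ⊕ ({s : Finset (Fin (2*n+1+m)) // n + m < s.card} × (Fin (2*n+1+m) → ℚ))
  let GJ : J → Y → Set (BoundedContinuousFunction X (EuclideanSpace ℝ (Fin (2*n+1+m)))) :=
    fun j => Sum.elim (fun q : ℕ => GP f h (1 / ((q : ℝ) + 1)))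
      (fun sr => GQ f sr.1.1 (fun i => (sr.2 i : ℝ))) j
  have hJO : ∀ j, PropO f (GJ j) := by
    rintro (q | sr)
    · exact GP_O f hclosed h h.continuous _
    · exact GQ_O f hclosed _ _
  have hJZ : ∀ j, PropZ m f (GJ j) := by
    rintro (q | sr)
    · exact GP_Z (by omega) f hcont hsurj hdimf h h.continuous _ (by positivity)
    · exact GQ_Z f hcont hsurj hdimf _ _ sr.1.2
  obtain ⟨e, he⟩ := exists_surjective_nat J
  rw [Metric.dense_iff]
  intro g0 ρ hρ
  let G0 : BoundedContinuousFunction X (EuclideanSpace ℝ (Fin (2*n+1+m))) :=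
    BoundedContinuousFunction.comp Subtype.val (LipschitzWith.subtype_val _) g0
  have hG0 : ∀ x, G0 x = (g0 x).1 := fun x => rfl
  let c : BoundedContinuousFunction X (EuclideanSpace ℝ (Fin (2*n+1+m))) :=
    BoundedContinuousFunction.const X (WithLp.toLp 2 fun _ => (1 / 2 : ℝ))
  set B := ‖c - G0‖ + 1 with hB
  have hB0 : 0 < B := by positivity
  set t := min 1 (ρ / (4 * B)) with ht
  have ht0 : 0 < t := lt_min one_pos (by positivity)
  have ht1 : t ≤ 1 := min_le_left _ _
  have htB : t * B ≤ ρ / 4 := by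
    have : t ≤ ρ / (4 * B) := min_le_right _ _
    calc t * B ≤ ρ / (4 * B) * B := by gcongr
      _ = ρ / 4 := by field_simp
  let g := G0 + t • (c - G0)
  have hgG : ∀ x, dist (g x) (G0 x) ≤ ρ / 4 := by
    intro x
    rw [dist_eq_norm]
    have e1 : g x - G0 x = t • ((c - G0) x) := by
      change G0 x + t • ((c - G0) x) - G0 x = _
      abel
    rw [e1, norm_smul, Real.norm_eq_abs, abs_of_pos ht0]
    refine le_trans ?_ htB
    gcongr
    exact ((c - G0).norm_coe_le_norm x).trans (by rw [hB]; linarith)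
  obtain ⟨u, hu1, hu2⟩ := baire hdimY f hcont hclosed (fun i => GJ (e i)) (fun i => hJO _)
    (fun i => hJZ _) g (min (t / 2) (ρ / 4)) (lt_min (by positivity) (by positivity))
  have hu3 : ∀ j y, u ∈ GJ j y := by
    intro j y
    obtain ⟨i, rfl⟩ := he j
    exact hu2 i y
  have hcube : ∀ x, u x ∈ cube (2*n+1+m) := by
    intro x i
    have k1 : |u x i - g x i| ≤ t / 2 := by
      have := PiLp.norm_apply_le (u x - g x) i
      rw [← dist_eq_norm] at this
      exact (this.trans (hu1 x)).trans (min_le_left _ _)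
    have k2 : g x i = (g0 x).1 i + t * (1 / 2 - (g0 x).1 i) := rfl
    have k3 := (g0 x).2 i
    rw [abs_le, k2] at k1
    obtain ⟨k4, k5⟩ := k3
    constructor <;> nlinarith
  let g1 : BoundedContinuousFunction X ↥(cube (2*n+1+m)) :=
    BoundedContinuousFunction.codRestrict (cube (2*n+1+m)) u hcube
  have hg1 : ∀ x, (g1 x : EuclideanSpace ℝ (Fin (2*n+1+m))) = u x := fun x => rfl
  refine ⟨g1, ?_, ?_, ?_⟩
  · rw [Metric.mem_ball]
    refine lt_of_le_of_lt ((BoundedContinuousFunction.dist_le (C := ρ / 2) (by positivity)).2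
      fun x => ?_) (by linarith)
    rw [Subtype.dist_eq, hg1, ← hG0]
    have := dist_triangle (u x) (g x) (G0 x)
    have := hgG x
    have := (hu1 x).trans (min_le_right _ _)
    linarith
  · have hE := embed_of_GP f hcont hclosed h h.continuous hh.isInducing u
      (fun q y => hu3 (Sum.inl q) y)
    refine IsEmbedding.of_comp (g := Prod.map id Subtype.val) ?_ (by fun_prop) hE
    exact hcont.prodMk g1.continuous
  · exact condR_of_GQ n m f u (fun s r hs y => hu3 (Sum.inr (⟨s, hs⟩, r)) y) _ hg1
end
end

section
/- Let f : X → Y be a perfect surjection between paracompact Hausdorff spaces with dim f ≤ n, and suppose there exists a continuous map h : X → I^n such that the map f × h : X → Y × I^n is 0-dimensional (every fiber of f × h has covering dimension ≤ 0). Then X can be covered by n + 1 sets A_1, …, A_{n+1}, each a G_δ-subset of X, such that each restriction f|A_i is a 0-dimensional map (every fiber f⁻¹(y) ∩ A_i has covering dimension ≤ 0). -/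
open Set Topology

noncomputable section

theorem covDimLE_homeo {S T : Type*} [TopologicalSpace S] [TopologicalSpace T] (e : S ≃ₜ T)
    {n : ℤ} (hT : CovDimLE T n) : CovDimLE S n := by
  intro ι U hι hU hcov
  obtain ⟨V, hVo, hVU, hVc, hV⟩ := hT ι (fun i => e.symm ⁻¹' U i) hι
    (fun i => (hU i).preimage e.symm.continuous) (by
      rw [← preimage_iUnion, hcov, preimage_univ])
  refine ⟨fun i => e ⁻¹' V i, fun i => (hVo i).preimage e.continuous, ?_, ?_, ?_⟩
  · intro i x hx
    simpa using hVU i hx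
  · rw [← preimage_iUnion, hVc, preimage_univ]
  · intro x
    exact hV (e x)

/-- local step over a single fibre -/
theorem fibre_step {S D : Type*} [TopologicalSpace S] [TopologicalSpace D] [T2Space S]
    (g : S → D) (hcl : IsClosedMap g) (hcomp : ∀ z, IsCompact (g ⁻¹' {z}))
    (hdim : ∀ z, CovDimLE ↥(g ⁻¹' {z}) 0) {ι : Type} [Finite ι] (U : ι → Set S)
    (hU : ∀ i, IsOpen (U i)) (hcov : (⋃ i, U i) = univ) (z : D) :
    ∃ (O : ι → Set S) (W : Set D), (∀ i, IsOpen (O i)) ∧ (∀ i, O i ⊆ U i) ∧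
      Pairwise (Function.onFun Disjoint O) ∧ IsOpen W ∧ z ∈ W ∧ g ⁻¹' W ⊆ ⋃ i, O i := by
  obtain ⟨V, hVo, hVU, hVc, hV⟩ := hdim z ι (fun i => Subtype.val ⁻¹' U i) inferInstance
    (fun i => (hU i).preimage continuous_subtype_val) (by
      rw [← preimage_iUnion, hcov, preimage_univ])
  have hVd : ∀ i j x, x ∈ V i → x ∈ V j → i = j := by
    intro i j x hi hj
    have h1 : ({i | x ∈ V i}).ncard ≤ 1 := by
      have := hV x
      rw [zero_add] at this
      exact_mod_cast this
    exact (Set.ncard_le_one (Set.toFinite _)).1 h1 i hi j hj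
  haveI : CompactSpace ↥(g ⁻¹' {z}) := isCompact_iff_compactSpace.1 (hcomp z)
  have hVclosed : ∀ i, IsClosed (V i) := by
    intro i
    have : (V i)ᶜ = ⋃ j, ⋃ (_ : j ≠ i), V j := by
      ext x
      simp only [mem_compl_iff, mem_iUnion, exists_prop]
      constructor
      · intro hx
        have : x ∈ ⋃ i, V i := hVc ▸ mem_univ x
        obtain ⟨j, hj⟩ := mem_iUnion.1 this
        exact ⟨j, fun h => hx (h ▸ hj), hj⟩
      · rintro ⟨j, hji, hj⟩ hx
        exact hji (hVd j i x hj hx)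
    rw [← isOpen_compl_iff, this]
    exact isOpen_iUnion fun j => isOpen_iUnion fun _ => hVo j
  have hK : ∀ i, IsCompact (Subtype.val '' V i : Set S) := fun i =>
    (hVclosed i).isCompact.image continuous_subtype_val
  have hdisj : Pairwise (Function.onFun Disjoint fun i => nhdsSet (Subtype.val '' V i : Set S)) := by
    intro i j hij
    apply SeparatedNhds.disjoint_nhdsSet
    apply SeparatedNhds.of_isCompact_isCompact (hK i) (hK j)
    rw [Set.disjoint_left]
    rintro _ ⟨a, ha, rfl⟩ ⟨b, hb, hab⟩
    have := Subtype.ext hab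
    subst this
    exact hij (hVd _ _ _ ha hb)
  obtain ⟨s, hs, hsd⟩ := hdisj.exists_mem_filter_of_disjoint
  refine ⟨fun i => interior (s i) ∩ U i, (g '' (⋃ i, interior (s i) ∩ U i)ᶜ)ᶜ,
    fun i => isOpen_interior.inter (hU i), fun i => inter_subset_right, ?_, ?_, ?_, ?_⟩
  · intro i j hij
    exact (hsd hij).mono (inter_subset_left.trans interior_subset)
      (inter_subset_left.trans interior_subset)
  · rw [isOpen_compl_iff]
    apply hcl
    rw [isClosed_compl_iff]
    exact isOpen_iUnion fun i => isOpen_interior.inter (hU i)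
  · rintro ⟨x, hx, hxz⟩
    apply hx
    have : (⟨x, hxz⟩ : ↥(g ⁻¹' {z})) ∈ ⋃ i, V i := hVc ▸ mem_univ _
    obtain ⟨i, hi⟩ := mem_iUnion.1 this
    exact mem_iUnion.2 ⟨i, subset_interior_iff_mem_nhdsSet.2 (hs i) ⟨_, hi, rfl⟩, hVU i hi⟩
  · intro x hx
    by_contra hx'
    exact hx ⟨x, hx', rfl⟩

theorem covDim_of_fibres {S D : Type*} [TopologicalSpace S] [TopologicalSpace D] [T2Space S]
    [LindelofSpace D]
    (hD : ∀ (z : D) (W : Set D), IsOpen W → z ∈ W → ∃ W', IsClopen W' ∧ z ∈ W' ∧ W' ⊆ W)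
    (g : S → D) (hc : Continuous g) (hcl : IsClosedMap g) (hcomp : ∀ z, IsCompact (g ⁻¹' {z}))
    (hdim : ∀ z, CovDimLE ↥(g ⁻¹' {z}) 0) : CovDimLE S 0 := by
  intro ι U hι hU hcov
  have key : ∀ z : D, ∃ (O : ι → Set S) (W : Set D), (∀ i, IsOpen (O i)) ∧ (∀ i, O i ⊆ U i) ∧
      Pairwise (Function.onFun Disjoint O) ∧ IsClopen W ∧ z ∈ W ∧ g ⁻¹' W ⊆ ⋃ i, O i := by
    intro z
    obtain ⟨O, W, h1, h2, h3, h4, h5, h6⟩ := fibre_step g hcl hcomp hdim U hU hcov z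
    obtain ⟨W', a, b, c⟩ := hD z W h4 h5
    exact ⟨O, W', h1, h2, h3, a, b, (preimage_mono c).trans h6⟩
  choose O W hO hOU hOd hW hzW hWO using key
  rcases isEmpty_or_nonempty D with hemp | hne
  · haveI : IsEmpty S := ⟨fun s => hemp.false (g s)⟩
    exact ⟨U, hU, fun i => subset_rfl, hcov, fun x => isEmptyElim x⟩
  obtain ⟨t, htc, ht⟩ := isLindelof_univ.elim_countable_subcover W (fun z => (hW z).isOpen)
    (fun z _ => mem_iUnion.2 ⟨z, hzW z⟩)
  have htne : t.Nonempty := by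
    obtain ⟨z⟩ := hne
    obtain ⟨w, hw, -⟩ := mem_iUnion₂.1 (ht (mem_univ z))
    exact ⟨w, hw⟩
  obtain ⟨c, rfl⟩ := htc.exists_eq_range htne
  let P : ℕ → Set D := disjointed fun k => W (c k)
  have hPd : Pairwise (Function.onFun Disjoint P) := disjoint_disjointed _
  have hPo : ∀ k, IsOpen (P k) := by
    intro k
    show IsOpen (disjointed _ k)
    rw [disjointed_eq_inter_compl]
    exact (hW _).isOpen.inter ((Set.finite_lt_nat k).isOpen_biInter fun j _ => (hW _).compl.isOpen)
  have hPW : ∀ k, P k ⊆ W (c k) := fun k => disjointed_subset _ k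
  have hPc : ∀ z, ∃ k, z ∈ P k := by
    intro z
    have : z ∈ ⋃ k, P k := by
      show z ∈ ⋃ k, disjointed (fun k => W (c k)) k
      rw [iUnion_disjointed]
      simpa using ht (mem_univ z)
    exact mem_iUnion.1 this
  refine ⟨fun i => ⋃ k, g ⁻¹' P k ∩ O (c k) i, ?_, ?_, ?_, ?_⟩
  · exact fun i => isOpen_iUnion fun k => ((hPo k).preimage hc).inter (hO _ i)
  · exact fun i => iUnion_subset fun k => inter_subset_right.trans (hOU _ i)
  · rw [eq_univ_iff_forall]
    intro x
    obtain ⟨k, hk⟩ := hPc (g x)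
    obtain ⟨i, hi⟩ := mem_iUnion.1 (hWO (c k) (hPW k hk))
    exact mem_iUnion.2 ⟨i, mem_iUnion.2 ⟨k, hk, hi⟩⟩
  · intro x
    have : ({i | x ∈ ⋃ k, g ⁻¹' P k ∩ O (c k) i}).ncard ≤ 1 := by
      rw [Set.ncard_le_one (Set.toFinite _)]
      intro i hi j hj
      obtain ⟨k, hk, hki⟩ := mem_iUnion.1 hi
      obtain ⟨l, hl, hlj⟩ := mem_iUnion.1 hj
      have hkl : k = l := by
        by_contra hne
        exact Set.disjoint_left.1 (hPd hne) hk hl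
      subst hkl
      by_contra hne
      exact Set.disjoint_left.1 (hOd _ hne) hki hlj
    simpa using this

/-- disjoint translates of the rationals -/
def shiftQ (i : ℕ) : Set ℝ := range fun q : ℚ => (q : ℝ) + i * √2

theorem shiftQ_countable (i : ℕ) : (shiftQ i).Countable := countable_range _

theorem shiftQ_between (i : ℕ) {a b : ℝ} (hab : a < b) : ∃ c ∈ shiftQ i, a < c ∧ c < b := by
  obtain ⟨q, h1, h2⟩ := exists_rat_btwn (show a - i * √2 < b - i * √2 by linarith)
  exact ⟨_, ⟨q, rfl⟩, by linarith, by linarith⟩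

theorem shiftQ_disj {i j : ℕ} {x : ℝ} (hi : x ∈ shiftQ i) (hj : x ∈ shiftQ j) : i = j := by
  obtain ⟨p, rfl⟩ := hi
  obtain ⟨q, hq⟩ := hj
  by_contra hne
  have h1 : ((i : ℝ) - j) ≠ 0 := sub_ne_zero.2 (by exact_mod_cast hne)
  apply irrational_sqrt_two
  refine ⟨(q - p) / ((i : ℚ) - j), ?_⟩
  push_cast
  rw [div_eq_iff h1]
  simp only at hq
  linarith

/-- the zero-dimensional pieces of the cube -/
def cubePiece (n i : ℕ) : Set ↥(cube n) := {x | ∀ j, x.1 j ∉ shiftQ i}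

theorem cubePiece_gdelta (n i : ℕ) : IsGδ (cubePiece n i) := by
  have : cubePiece n i = ⋂ j : Fin n, (fun x : ↥(cube n) => x.1 j) ⁻¹' (shiftQ i)ᶜ := by
    ext x; simp [cubePiece]
  rw [this]
  refine IsGδ.iInter fun j => ?_
  exact (shiftQ_countable i).isGδ_compl.preimage (by fun_prop)

theorem cubePiece_cover (n : ℕ) (x : ↥(cube n)) : ∃ i : Fin (n + 1), x ∈ cubePiece n i := by
  by_contra! hx
  simp only [cubePiece, mem_setOf_eq, not_forall, not_not] at hx
  choose j hj using hx
  obtain ⟨a, b, hab, he⟩ := Fintype.exists_ne_map_eq_of_card_lt j (by simp)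
  exact hab (Fin.ext (shiftQ_disj (hj a) (he ▸ hj b)))

theorem cubePiece_clopen (n i : ℕ) (z : ↥(cubePiece n i)) (W : Set ↥(cubePiece n i))
    (hW : IsOpen W) (hz : z ∈ W) : ∃ W', IsClopen W' ∧ z ∈ W' ∧ W' ⊆ W := by
  let φ : ↥(cubePiece n i) → (Fin n → ℝ) := fun x j => x.1.1 j
  have hφ : IsInducing φ :=
    (PiLp.homeomorph 2 (fun _ : Fin n => ℝ)).isInducing.comp
      (IsInducing.subtypeVal.comp IsInducing.subtypeVal)
  obtain ⟨O, hO, rfl⟩ := hφ.isOpen_iff.1 hW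
  obtain ⟨ε, hε, hball⟩ := Metric.isOpen_iff.1 hO (φ z) hz
  choose a ha ha1 ha2 using fun j => shiftQ_between i (show φ z j - ε < φ z j by linarith)
  choose b hb hb1 hb2 using fun j => shiftQ_between i (show φ z j < φ z j + ε by linarith)
  have hcont : ∀ j, Continuous fun x => φ x j := fun j => (continuous_apply j).comp hφ.continuous
  refine ⟨⋂ j, {x | a j < φ x j ∧ φ x j < b j}, ⟨?_, ?_⟩, ?_, ?_⟩
  · have : (⋂ j, {x | a j < φ x j ∧ φ x j < b j}) = ⋂ j, {x | a j ≤ φ x j ∧ φ x j ≤ b j} := by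
      refine iInter_congr fun j => ?_
      ext x
      constructor
      · exact fun h => ⟨h.1.le, h.2.le⟩
      · exact fun h => ⟨lt_of_le_of_ne h.1 fun e => x.2 j (show φ x j ∈ _ from e ▸ ha j),
          lt_of_le_of_ne h.2 fun e => x.2 j (show φ x j ∈ _ from e ▸ hb j)⟩
    rw [this]
    exact isClosed_iInter fun j => (isClosed_le continuous_const (hcont j)).inter
      (isClosed_le (hcont j) continuous_const)
  · exact isOpen_iInter_of_finite fun j => (isOpen_lt continuous_const (hcont j)).inter
      (isOpen_lt (hcont j) continuous_const)
  · exact mem_iInter.2 fun j => ⟨ha2 j, hb1 j⟩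
  · intro x hx
    apply hball
    rw [Metric.mem_ball, dist_pi_lt_iff hε]
    intro j
    have := mem_iInter.1 hx j
    rw [Real.dist_eq, abs_lt]
    have h1 := this.1
    have h2 := this.2
    have := ha1 j
    have := hb2 j
    constructor <;> linarith

/-- construction in Proposition 4.3. Let `f : X → Y` be a perfect surjection
between paracompact Hausdorff spaces with `dim f ≤ n`, and suppose there is a continuous
`h : X → I^n` such that `f × h` is `0`-dimensional. Then `X` is covered by `n + 1` many
`G_δ`-sets `A_1, …, A_{n+1}` such that each restriction `f|A_i` is `0`-dimensional. -/
theorem stmt18 {X Y : Type*} [TopologicalSpace X] [TopologicalSpace Y]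
    [T2Space X] [T2Space Y] [ParacompactSpace X] [ParacompactSpace Y]
    (n : ℕ) (f : X → Y) (hperf : IsPerfectMap f) (hsurj : Function.Surjective f)
    (hdimf : ∀ y : Y, CovDimLE ↥(f ⁻¹' {y}) n)
    (h : C(X, ↥(cube n)))
    (hdimfh : ∀ p : Y × ↥(cube n),
      CovDimLE ↥((fun x => (f x, h x)) ⁻¹' {p}) 0) :
    ∃ A : Fin (n + 1) → Set X,
      (∀ i, IsGδ (A i)) ∧ (⋃ i, A i) = Set.univ ∧
      ∀ i, ∀ y : Y, CovDimLE ↥(f ⁻¹' {y} ∩ A i) 0 := by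
  refine ⟨fun i => h ⁻¹' cubePiece n i, fun i => (cubePiece_gdelta n i).preimage h.continuous,
    ?_, ?_⟩
  · rw [eq_univ_iff_forall]
    intro x
    obtain ⟨i, hi⟩ := cubePiece_cover n (h x)
    exact mem_iUnion.2 ⟨i, hi⟩
  · intro i y
    have hK := hperf.2.2 y
    let g : ↥(f ⁻¹' {y} ∩ h ⁻¹' cubePiece n i) → ↥(cubePiece n i) := fun x => ⟨h x.1, x.2.2⟩
    have hg : Continuous g := by fun_prop
    have hcl : IsClosedMap g := by
      intro C hC
      obtain ⟨C', hC', rfl⟩ := isClosed_induced_iff.1 hC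
      have : g '' (Subtype.val ⁻¹' C') = Subtype.val ⁻¹' (h '' (f ⁻¹' {y} ∩ C')) := by
        ext z
        constructor
        · rintro ⟨x, hx, rfl⟩
          exact ⟨x.1, ⟨x.2.1, hx⟩, rfl⟩
        · rintro ⟨x, ⟨hx, hxC⟩, hxz⟩
          exact ⟨⟨x, hx, by rw [mem_preimage, hxz]; exact z.2⟩, hxC, Subtype.ext hxz⟩
      rw [this]
      exact ((hK.inter_right hC').image h.continuous).isClosed.preimage continuous_subtype_val
    have hcomp : ∀ z, IsCompact (g ⁻¹' {z}) := by
      intro z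
      rw [Subtype.isCompact_iff]
      have : Subtype.val '' (g ⁻¹' {z}) = f ⁻¹' {y} ∩ h ⁻¹' {z.1} := by
        ext x
        constructor
        · rintro ⟨w, hw, rfl⟩
          exact ⟨w.2.1, congrArg Subtype.val hw⟩
        · rintro ⟨hx, hxz⟩
          have hxz' : h x = z.1 := hxz
          exact ⟨⟨x, hx, by rw [mem_preimage, hxz']; exact z.2⟩, Subtype.ext hxz', rfl⟩
      rw [this]
      exact hK.inter_right (isClosed_singleton.preimage h.continuous)
    refine covDim_of_fibres (cubePiece_clopen n i) g hg hcl hcomp fun z => ?_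
    refine covDimLE_homeo ?_ (hdimfh (y, z.1))
    exact
      { toFun := fun x => ⟨x.1.1, Prod.ext x.1.2.1 (congrArg Subtype.val x.2)⟩
        invFun := fun x => ⟨⟨x.1, congrArg Prod.fst x.2, by
            have : h x.1 = z.1 := congrArg Prod.snd x.2
            rw [mem_preimage, this]; exact z.2⟩, Subtype.ext (congrArg Prod.snd x.2)⟩
        left_inv := fun x => rfl
        right_inv := fun x => rfl
        continuous_toFun := by fun_prop
        continuous_invFun := by fun_prop }
end
end
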